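/- arXiv:1406.7748 — 3 statements merged into one kernel-verified Lean document; each statement's English description precedes it below -/
import Mathlib

section
/- Let 1/2 < α ≤ 1 and 1/2 < β ≤ 1, let x : [0,1]² → ℝ be continuous with 𝒩_{α,β}(x) < ∞, and let φ ∈ C⁴(ℝ). Then for every rectangle [s,s′]×[t,t′] ⊆ [0,1]² the following two limits over grid partitions Π (with points σ₀ < … < σ_m of [s,s′] and τ₀ < … < τ_n of [t,t′]) exist as |Π| → 0: I₁ = lim Σ_{i,j} φ′(x(σ_i,τ_j))·(δx)(σ_i,σ_{i+1};τ_j,τ_{j+1}) and I₂ = lim Σ_{i,j} φ″(x(σ_i,τ_j))·(δ₁x)(σ_i,σ_{i+1};τ_j)·(δ₂x)(σ_i;τ_j,τ_{j+1}); moreover the two-dimensional change-of-variables (Stratonovich–Young) formula (δ(φ∘x))(s,s′;t,t′) = I₁ + I₂ holds. -/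
open Set

/-- Rectangular increment `(δf)(s₁,s₂;t₁,t₂)`. -/
def dd (f : ℝ → ℝ → ℝ) (s₁ s₂ t₁ t₂ : ℝ) : ℝ :=
  f s₂ t₂ - f s₁ t₂ - f s₂ t₁ + f s₁ t₁

/-- Increment in the first direction `(δ₁f)(s₁,s₂;t)`. -/
def d1 (f : ℝ → ℝ → ℝ) (s₁ s₂ t : ℝ) : ℝ := f s₂ t - f s₁ t

/-- Increment in the second direction `(δ₂f)(s;t₁,t₂)`. -/
def d2 (f : ℝ → ℝ → ℝ) (s t₁ t₂ : ℝ) : ℝ := f s t₂ - f s t₁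

/-- `σ` is a grid of `[a,b]` with `m` subintervals. -/
def IsGrid (a b : ℝ) (m : ℕ) (σ : ℕ → ℝ) : Prop :=
  σ 0 = a ∧ σ m = b ∧ ∀ i < m, σ i < σ (i + 1)

/-- The mesh of the grid `σ` is at most `η`. -/
def MeshLE (m : ℕ) (σ : ℕ → ℝ) (η : ℝ) : Prop :=
  ∀ i < m, σ (i + 1) - σ i ≤ η

/-- Convergence of two-dimensional Riemann sums with local summand
`F σᵢ σᵢ₊₁ τⱼ τⱼ₊₁` over grid partitions of `[s,s']×[t,t']` to the limit `L`. -/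
def RConv (s s' t t' : ℝ) (F : ℝ → ℝ → ℝ → ℝ → ℝ) (L : ℝ) : Prop :=
  ∀ ε > (0:ℝ), ∃ η > (0:ℝ), ∀ (m n : ℕ) (σ τ : ℕ → ℝ),
    IsGrid s s' m σ → IsGrid t t' n τ → MeshLE m σ η → MeshLE n τ η →
    |(∑ i ∈ Finset.range m, ∑ j ∈ Finset.range n,
        F (σ i) (σ (i + 1)) (τ j) (τ (j + 1))) - L| ≤ ε

/-- `𝒩_{ρ₁,ρ₂}(f) < ∞` on `[0,1]²`. -/
def NFin (ρ₁ ρ₂ : ℝ) (f : ℝ → ℝ → ℝ) : Prop :=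
  ∃ C : ℝ,
    (∀ s₁ s₂ t₁ t₂ : ℝ, s₁ ∈ Icc (0:ℝ) 1 → s₂ ∈ Icc (0:ℝ) 1 →
      t₁ ∈ Icc (0:ℝ) 1 → t₂ ∈ Icc (0:ℝ) 1 →
      |dd f s₁ s₂ t₁ t₂| ≤ C * |s₂ - s₁| ^ ρ₁ * |t₂ - t₁| ^ ρ₂) ∧
    (∀ s₁ s₂ t : ℝ, s₁ ∈ Icc (0:ℝ) 1 → s₂ ∈ Icc (0:ℝ) 1 → t ∈ Icc (0:ℝ) 1 →
      |d1 f s₁ s₂ t| ≤ C * |s₂ - s₁| ^ ρ₁) ∧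
    (∀ s t₁ t₂ : ℝ, s ∈ Icc (0:ℝ) 1 → t₁ ∈ Icc (0:ℝ) 1 → t₂ ∈ Icc (0:ℝ) 1 →
      |d2 f s t₁ t₂| ≤ C * |t₂ - t₁| ^ ρ₂) ∧
    (∀ s t : ℝ, s ∈ Icc (0:ℝ) 1 → t ∈ Icc (0:ℝ) 1 → |f s t| ≤ C)

/-- The increments of a monotone sequence telescope, so the sum of their `θ`-th powers is at most
the `(θ - 1)`-th power of the mesh times the total length. -/
theorem sum_increment_rpow_le {θ η : ℝ} (hθ : 1 < θ) {σ : ℕ → ℝ} (hσ : Monotone σ) {m : ℕ}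
    (hmesh : MeshLE m σ η) :
    ∑ i ∈ Finset.range m, (σ (i + 1) - σ i) ^ θ ≤ η ^ (θ - 1) * (σ m - σ 0) := by
  rw [← Finset.sum_range_sub, Finset.mul_sum]
  refine Finset.sum_le_sum fun i hi => ?_
  have h0 : 0 ≤ σ (i + 1) - σ i := sub_nonneg.2 (hσ i.le_succ)
  have h1 : (σ (i + 1) - σ i) ^ θ = (σ (i + 1) - σ i) ^ (θ - 1) * (σ (i + 1) - σ i) := by
    nth_rewrite 3 [← Real.rpow_one (σ (i + 1) - σ i)]
    rw [← Real.rpow_add_of_nonneg h0 (by linarith) zero_le_one, sub_add_cancel]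
  rw [h1]
  exact mul_le_mul_of_nonneg_right
    (Real.rpow_le_rpow h0 (hmesh i (Finset.mem_range.1 hi)) (by linarith)) h0

theorem exists_crossing {σ : ℕ → ℝ} {M : ℝ} {p q : ℕ} (hpq : p < q) (hp : σ p ≤ M)
    (hq : M ≤ σ q) : ∃ i, p ≤ i ∧ i < q ∧ σ i ≤ M ∧ M ≤ σ (i + 1) := by
  induction q, hpq using Nat.le_induction with
  | base => exact ⟨p, le_rfl, p.lt_succ_self, hp, hq⟩
  | succ q hq' ih =>
    rcases le_total M (σ q) with h | h
    · obtain ⟨i, h1, h2, h3⟩ := ih h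
      exact ⟨i, h1, h2.trans q.lt_succ_self, h3⟩
    · exact ⟨q, by omega, q.lt_succ_self, h, hq⟩

/-- The constant in the Young–Loève estimate for control exponent `θ`. -/
noncomputable def youngConst (θ : ℝ) : ℝ := 2 / (1 - 2 * (1 / 2) ^ θ)

theorem two_mul_half_rpow_lt_one {θ : ℝ} (hθ : 1 < θ) : 2 * (1 / 2 : ℝ) ^ θ < 1 := by
  have := Real.rpow_lt_rpow_of_exponent_gt (by norm_num : (0 : ℝ) < 1 / 2) (by norm_num) hθ
  rw [Real.rpow_one] at this
  linarith

theorem youngConst_pos {θ : ℝ} (hθ : 1 < θ) : 0 < youngConst θ :=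
  div_pos two_pos (sub_pos.2 (two_mul_half_rpow_lt_one hθ))

/-- `Ξ` is additive on `[u,v]` up to a defect of order `K |d - c| ^ θ`. -/
def DefectLE (u v K θ : ℝ) (Ξ : ℝ → ℝ → ℝ) : Prop :=
  ∀ c n d, u ≤ c → c ≤ n → n ≤ d → d ≤ v → |Ξ c d - Ξ c n - Ξ n d| ≤ K * (d - c) ^ θ

theorem DefectLE.diag {u v K θ : ℝ} {Ξ : ℝ → ℝ → ℝ} (h : DefectLE u v K θ Ξ) (hθ : 1 < θ)
    {c : ℝ} (hu : u ≤ c) (hv : c ≤ v) : Ξ c c = 0 := by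
  have := h c c c hu le_rfl le_rfl hv
  rw [sub_self, sub_self, Real.zero_rpow (by linarith), mul_zero, zero_sub, abs_neg] at this
  exact abs_eq_zero.1 (le_antisymm this (abs_nonneg _))

/-- Young–Loève estimate for sums over consecutive points of a monotone sequence. -/
theorem DefectLE.abs_sum_Ico_sub_le {u v K θ : ℝ} {Ξ : ℝ → ℝ → ℝ} (h : DefectLE u v K θ Ξ)
    (hK : 0 ≤ K) (hθ : 1 < θ) {σ : ℕ → ℝ} (hσ : Monotone σ) {p q : ℕ} (hpq : p ≤ q)
    (hu : u ≤ σ p) (hv : σ q ≤ v) :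
    |∑ i ∈ Finset.Ico p q, Ξ (σ i) (σ (i + 1)) - Ξ (σ p) (σ q)| ≤
      youngConst θ * K * (σ q - σ p) ^ θ := by
  induction hk : q - p using Nat.strong_induction_on generalizing p q with
  | _ k ih =>
  have hC := youngConst_pos hθ
  rcases hpq.eq_or_lt with rfl | hlt
  · rw [Finset.Ico_self, Finset.sum_empty, h.diag hθ hu hv]
    simp only [sub_self, abs_zero]
    rw [Real.zero_rpow (by linarith), mul_zero]
  have hle : σ p ≤ σ q := hσ hpq
  obtain ⟨i, hpi, hiq, hi, hi'⟩ := exists_crossing (σ := σ) (M := (σ p + σ q) / 2) hlt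
    (by linarith) (by linarith)
  have m1 := hσ hpi
  have m2 := hσ i.le_succ
  have m3 : σ (i + 1) ≤ σ q := hσ hiq
  simp only [Nat.succ_eq_add_one] at m2
  have e1 := ih (i - p) (by omega) hpi hu (by linarith) rfl
  have e2 := ih (q - (i + 1)) (by omega) (p := i + 1) hiq (by linarith) hv rfl
  have e3 := h (σ p) (σ i) (σ q) hu m1 (by linarith) hv
  have e4 := h (σ i) (σ (i + 1)) (σ q) (by linarith) m2 m3 hv
  set ℓ := σ q - σ p with hℓ
  have hhalf : ∀ r, 0 ≤ r → r ≤ ℓ / 2 → r ^ θ ≤ (1 / 2) ^ θ * ℓ ^ θ := fun r h0 h1 => by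
    rw [← Real.mul_rpow (by norm_num) (by linarith)]
    exact Real.rpow_le_rpow h0 (by linarith) (by linarith)
  have f1 := hhalf (σ i - σ p) (by linarith) (by linarith)
  have f2 := hhalf (σ q - σ (i + 1)) (by linarith) (by linarith)
  have f4 : (σ q - σ i) ^ θ ≤ ℓ ^ θ :=
    Real.rpow_le_rpow (by linarith) (by linarith) (by linarith)
  have hsum : ∑ j ∈ Finset.Ico p q, Ξ (σ j) (σ (j + 1)) =
      ∑ j ∈ Finset.Ico p i, Ξ (σ j) (σ (j + 1)) + (Ξ (σ i) (σ (i + 1)) +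
        ∑ j ∈ Finset.Ico (i + 1) q, Ξ (σ j) (σ (j + 1))) := by
    rw [← Finset.sum_Ico_consecutive _ hpi hiq.le, Finset.sum_eq_sum_Ico_succ_bot hiq]
  have g4 := mul_le_mul_of_nonneg_left f4 hK
  have hCK : 0 ≤ youngConst θ * K := by positivity
  have g1 := mul_le_mul_of_nonneg_left f1 hCK
  have g2 := mul_le_mul_of_nonneg_left f2 hCK
  have hid : youngConst θ * K * ℓ ^ θ =
      2 * (K * ℓ ^ θ) + 2 * (youngConst θ * K * ((1 / 2) ^ θ * ℓ ^ θ)) := by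
    have h1 : (1 - 2 * (1 / 2 : ℝ) ^ θ) ≠ 0 := (sub_pos.2 (two_mul_half_rpow_lt_one hθ)).ne'
    have h2 : youngConst θ = 2 + youngConst θ * (2 * (1 / 2 : ℝ) ^ θ) := by
      unfold youngConst
      field_simp
      ring
    linear_combination (K * ℓ ^ θ) * h2
  rw [hsum, hid]
  rw [abs_le] at e1 e2 e3 e4 ⊢
  constructor <;> linarith [e1.1, e1.2, e2.1, e2.2, e3.1, e3.2, e4.1, e4.2]

theorem DefectLE.abs_sum_sub_le {u v K θ : ℝ} {Ξ : ℝ → ℝ → ℝ} (h : DefectLE u v K θ Ξ)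
    (hK : 0 ≤ K) (hθ : 1 < θ) {σ : ℕ → ℝ} (hσ : Monotone σ) {m : ℕ}
    (hu : u ≤ σ 0) (hv : σ m ≤ v) :
    |∑ i ∈ Finset.range m, Ξ (σ i) (σ (i + 1)) - Ξ (σ 0) (σ m)| ≤
      youngConst θ * K * (σ m - σ 0) ^ θ := by
  rw [Finset.range_eq_Ico]
  exact h.abs_sum_Ico_sub_le hK hθ hσ m.zero_le hu hv

/-- The value of `Ξ` on the intersection of `[a,b]` and `[a',b']`, and `0` if they are disjoint. -/
noncomputable def interValue (Ξ : ℝ → ℝ → ℝ) (a b a' b' : ℝ) : ℝ :=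
  if max a a' ≤ min b b' then Ξ (max a a') (min b b') else 0

theorem interValue_comm (Ξ : ℝ → ℝ → ℝ) (a b a' b' : ℝ) :
    interValue Ξ a b a' b' = interValue Ξ a' b' a b := by
  unfold interValue
  rw [max_comm a, min_comm b]

/-- Refining the grid `σ` by the grid `τ` changes the Riemann sum by a power of the mesh. -/
theorem DefectLE.abs_sum_sub_sum_interValue_le {u v K θ η : ℝ} {Ξ : ℝ → ℝ → ℝ}
    (h : DefectLE u v K θ Ξ) (hK : 0 ≤ K) (hθ : 1 < θ) {σ τ : ℕ → ℝ} (hσ : Monotone σ)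
    (hτ : Monotone τ) {m n : ℕ} (hσ0 : σ 0 = u) (hσm : σ m = v) (hτ0 : τ 0 = u) (hτn : τ n = v)
    (hmesh : MeshLE m σ η) :
    |∑ i ∈ Finset.range m, Ξ (σ i) (σ (i + 1)) -
      ∑ i ∈ Finset.range m, ∑ j ∈ Finset.range n,
        interValue Ξ (σ i) (σ (i + 1)) (τ j) (τ (j + 1))| ≤
      youngConst θ * K * (η ^ (θ - 1) * (v - u)) := by
  have hCK : 0 ≤ youngConst θ * K := mul_nonneg (youngConst_pos hθ).le hK
  have key : ∀ i ∈ Finset.range m, |Ξ (σ i) (σ (i + 1)) -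
      ∑ j ∈ Finset.range n, interValue Ξ (σ i) (σ (i + 1)) (τ j) (τ (j + 1))| ≤
      youngConst θ * K * (σ (i + 1) - σ i) ^ θ := by
    intro i hi
    have hi : i < m := Finset.mem_range.1 hi
    have a1 : u ≤ σ i := hσ0 ▸ hσ i.zero_le
    have a2 : σ i ≤ σ (i + 1) := hσ i.le_succ
    have a3 : σ (i + 1) ≤ v := hσm ▸ hσ hi
    have hρ : Monotone fun j => max (σ i) (min (σ (i + 1)) (τ j)) := fun j k hjk =>
      max_le_max le_rfl (min_le_min le_rfl (hτ hjk))
    have hρ0 : max (σ i) (min (σ (i + 1)) (τ 0)) = σ i := by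
      rw [hτ0, min_eq_right (a1.trans a2), max_eq_left a1]
    have hρn : max (σ i) (min (σ (i + 1)) (τ n)) = σ (i + 1) := by
      rw [hτn, min_eq_left a3, max_eq_right a2]
    have := h.abs_sum_sub_le hK hθ hρ (m := n) (by simp only [hρ0, a1]) (by simp only [hρn, a3])
    simp only [hρ0, hρn] at this
    rw [abs_sub_comm]
    convert this using 3
    refine Finset.sum_congr rfl fun j _ => ?_
    have b : τ j ≤ τ (j + 1) := hτ j.le_succ
    unfold interValue
    split_ifs with hc
    · have c1 : τ j ≤ σ (i + 1) := (le_max_right _ _).trans (hc.trans (min_le_left _ _))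
      rw [min_eq_right c1, max_eq_right ((le_max_left _ _).trans hc)]
    · have hdiag : ∀ c, σ i ≤ c → c ≤ σ (i + 1) → Ξ c c = 0 := fun c h1 h2 =>
        h.diag hθ (a1.trans h1) (h2.trans a3)
      rcases lt_or_ge (σ (i + 1)) (τ j) with hlt | hge
      · rw [min_eq_left hlt.le, min_eq_left (hlt.le.trans b), max_eq_right a2,
          hdiag _ a2 le_rfl]
      · have : τ (j + 1) < σ i := by
          by_contra! hcon
          exact hc (max_le (le_min a2 hcon) (le_min hge b))
        rw [min_eq_right hge, min_eq_right (this.le.trans a2), max_eq_left (b.trans this.le),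
          max_eq_left this.le, hdiag _ le_rfl a2]
  rw [← Finset.sum_sub_distrib]
  refine (Finset.abs_sum_le_sum_abs _ _).trans ((Finset.sum_le_sum key).trans ?_)
  rw [← Finset.mul_sum, ← hσm, ← hσ0]
  exact mul_le_mul_of_nonneg_left (sum_increment_rpow_le hθ hσ hmesh) hCK

/-- Riemann sums of an almost additive function over two grids of the same interval are close. -/
theorem DefectLE.abs_sum_sub_sum_le {u v K θ η : ℝ} {Ξ : ℝ → ℝ → ℝ}
    (h : DefectLE u v K θ Ξ) (hK : 0 ≤ K) (hθ : 1 < θ) {σ τ : ℕ → ℝ} (hσ : Monotone σ)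
    (hτ : Monotone τ) {m n : ℕ} (hσ0 : σ 0 = u) (hσm : σ m = v) (hτ0 : τ 0 = u) (hτn : τ n = v)
    (hmσ : MeshLE m σ η) (hmτ : MeshLE n τ η) :
    |∑ i ∈ Finset.range m, Ξ (σ i) (σ (i + 1)) - ∑ j ∈ Finset.range n, Ξ (τ j) (τ (j + 1))| ≤
      2 * (youngConst θ * K * (η ^ (θ - 1) * (v - u))) := by
  have h1 := h.abs_sum_sub_sum_interValue_le hK hθ hσ hτ hσ0 hσm hτ0 hτn hmσ
  have h2 := h.abs_sum_sub_sum_interValue_le hK hθ hτ hσ hτ0 hτn hσ0 hσm hmτ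
  rw [Finset.sum_comm] at h2
  simp only [interValue_comm Ξ (τ _)] at h2
  rw [abs_sub_comm] at h2
  rw [two_mul]
  exact (abs_sub_le _ _ _).trans (add_le_add h1 h2)

/-- `F` is additive in each direction, and jointly in both, up to defects of order larger than one
in the side lengths. -/
structure RectDefectLE (s s' t t' K θ₁ θ₂ : ℝ) (F : ℝ → ℝ → ℝ → ℝ → ℝ) : Prop where
  left : ∀ c d, t ≤ c → c ≤ d → d ≤ t' → DefectLE s s' K θ₁ fun a b => F a b c d
  right : ∀ a b, s ≤ a → a ≤ b → b ≤ s' → DefectLE t t' K θ₂ fun c d => F a b c d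
  mixed : ∀ c n d, t ≤ c → c ≤ n → n ≤ d → d ≤ t' →
    DefectLE s s' (K * (d - c) ^ θ₂) θ₁ fun a b => F a b c d - F a b c n - F a b n d

theorem RectDefectLE.swap {s s' t t' K θ₁ θ₂ : ℝ} {F : ℝ → ℝ → ℝ → ℝ → ℝ}
    (h : RectDefectLE s s' t t' K θ₁ θ₂ F) :
    RectDefectLE t t' s s' K θ₂ θ₁ fun c d a b => F a b c d where
  left := h.right
  right := h.left
  mixed a m b h1 h2 h3 h4 c n d h5 h6 h7 h8 := by
    have := h.mixed c n d h5 h6 h7 h8 a m b h1 h2 h3 h4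
    rw [mul_right_comm]
    convert this using 2
    ring

/-- Riemann sum of `F` over a product grid. -/
def riemannSum (F : ℝ → ℝ → ℝ → ℝ → ℝ) (m n : ℕ) (σ τ : ℕ → ℝ) : ℝ :=
  ∑ i ∈ Finset.range m, ∑ j ∈ Finset.range n, F (σ i) (σ (i + 1)) (τ j) (τ (j + 1))

theorem riemannSum_swap (F : ℝ → ℝ → ℝ → ℝ → ℝ) (m n : ℕ) (σ τ : ℕ → ℝ) :
    riemannSum (fun c d a b => F a b c d) n m τ σ = riemannSum F m n σ τ :=
  Finset.sum_comm

/-- Changing the second grid changes the Riemann sum little, uniformly in the first grid. -/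
theorem RectDefectLE.abs_riemannSum_sub_le {s s' t t' K θ₁ θ₂ η : ℝ}
    {F : ℝ → ℝ → ℝ → ℝ → ℝ} (h : RectDefectLE s s' t t' K θ₁ θ₂ F) (hK : 0 ≤ K)
    (hθ₁ : 1 < θ₁) (hθ₂ : 1 < θ₂) {σ τ τ' : ℕ → ℝ} (hσ : Monotone σ) (hτ : Monotone τ)
    (hτ' : Monotone τ') {m n n' : ℕ} (hσ0 : σ 0 = s) (hσm : σ m = s') (hτ0 : τ 0 = t)
    (hτn : τ n = t') (hτ0' : τ' 0 = t) (hτn' : τ' n' = t')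
    (hmτ : MeshLE n τ η) (hmτ' : MeshLE n' τ' η) :
    |riemannSum F m n σ τ - riemannSum F m n' σ τ'| ≤
      2 * (youngConst θ₂ * (K + youngConst θ₁ * K * (s' - s) ^ θ₁) * (t' - t)) *
        η ^ (θ₂ - 1) := by
  have hs : s ≤ s' := hσ0 ▸ hσm ▸ hσ m.zero_le
  have hd : DefectLE t t' (K + youngConst θ₁ * K * (s' - s) ^ θ₁) θ₂
      fun c d => ∑ i ∈ Finset.range m, F (σ i) (σ (i + 1)) c d := by
    intro c n d h1 h2 h3 h4
    have hdc : 0 ≤ (d - c) ^ θ₂ := Real.rpow_nonneg (by linarith) _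
    have e1 := (h.mixed c n d h1 h2 h3 h4).abs_sum_sub_le (mul_nonneg hK hdc) hθ₁ hσ
      hσ0.ge hσm.le
    rw [hσ0, hσm] at e1
    have e2 := h.right s s' le_rfl hs le_rfl c n d h1 h2 h3 h4
    simp only [← Finset.sum_sub_distrib]
    rw [add_mul, add_comm]
    have e3 := (abs_add_le _ _).trans (add_le_add e1 e2)
    rw [sub_add_cancel] at e3
    refine e3.trans (le_of_eq ?_)
    ring
  have hK' : 0 ≤ K + youngConst θ₁ * K * (s' - s) ^ θ₁ :=
    add_nonneg hK (mul_nonneg (mul_nonneg (youngConst_pos hθ₁).le hK)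
      (Real.rpow_nonneg (by linarith) _))
  have := hd.abs_sum_sub_sum_le hK' hθ₂ hτ hτ' hτ0 hτn hτ0' hτn' hmτ hmτ'
  rw [Finset.sum_comm, Finset.sum_comm (s := Finset.range n')] at this
  refine this.trans (le_of_eq ?_)
  ring

theorem exists_pos_mul_rpow_le {p : ℝ} (hp : 0 < p) (B : ℝ) {ε : ℝ} (hε : 0 < ε) :
    ∃ η > (0 : ℝ), ∀ η' > 0, η' ≤ η → B * η' ^ p ≤ ε := by
  have h : Filter.Tendsto (fun η : ℝ => B * η ^ p) (nhds 0) (nhds 0) := by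
    have := ((Real.continuousAt_rpow_const 0 p (Or.inr hp.le)).tendsto).const_mul B
    simpa [Real.zero_rpow hp.ne'] using this
  obtain ⟨δ, hδ, hδ'⟩ := Metric.eventually_nhds_iff.1 (h.eventually (gt_mem_nhds hε))
  refine ⟨δ / 2, by positivity, fun η h0 h1 => (hδ' ?_).le⟩
  rw [Real.dist_eq, sub_zero, abs_of_pos h0]
  linarith

theorem IsGrid.exists_monotone {a b η : ℝ} {m : ℕ} {σ : ℕ → ℝ} (h : IsGrid a b m σ)
    (hm : MeshLE m σ η) : ∃ ρ : ℕ → ℝ, Monotone ρ ∧ ρ 0 = a ∧ ρ m = b ∧ MeshLE m ρ η ∧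
      ∀ i ≤ m, ρ i = σ i := by
  have he : ∀ i ≤ m, σ (min i m) = σ i := fun i hi => by rw [min_eq_left hi]
  refine ⟨fun i => σ (min i m), monotone_nat_of_le_succ fun i => ?_, ?_, ?_, ?_, he⟩
  · rcases lt_or_ge i m with hi | hi
    · rw [he i hi.le, he (i + 1) hi]
      exact (h.2.2 i hi).le
    · rw [min_eq_right hi, min_eq_right (hi.trans i.le_succ)]
  · exact (he 0 m.zero_le).trans h.1
  · exact (he m le_rfl).trans h.2.1
  · intro i hi
    simp only [he i hi.le, he (i + 1) hi]
    exact hm i hi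

theorem riemannSum_congr (F : ℝ → ℝ → ℝ → ℝ → ℝ) {m n : ℕ} {σ σ' τ τ' : ℕ → ℝ}
    (hσ : ∀ i ≤ m, σ i = σ' i) (hτ : ∀ j ≤ n, τ j = τ' j) :
    riemannSum F m n σ τ = riemannSum F m n σ' τ' := by
  refine Finset.sum_congr rfl fun i hi => Finset.sum_congr rfl fun j hj => ?_
  rw [Finset.mem_range] at hi hj
  rw [hσ i hi.le, hσ (i + 1) hi, hτ j hj.le, hτ (j + 1) hj]

theorem exists_isGrid {a b η : ℝ} (hab : a ≤ b) (hη : 0 < η) :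
    ∃ m σ, IsGrid a b m σ ∧ MeshLE m σ η := by
  rcases hab.eq_or_lt with rfl | hlt
  · exact ⟨0, fun _ => a, ⟨rfl, rfl, fun i hi => absurd hi i.not_lt_zero⟩,
      fun i hi => absurd hi i.not_lt_zero⟩
  · obtain ⟨N, hN⟩ := exists_nat_gt ((b - a) / η)
    have hpos : 0 < (N : ℝ) := lt_of_le_of_lt (div_nonneg (by linarith) hη.le) hN
    have hstep : ∀ i : ℕ, a + ((i + 1 : ℕ) : ℝ) * ((b - a) / N) - (a + i * ((b - a) / N)) =
        (b - a) / N := fun i => by push_cast; ring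
    refine ⟨N, fun i => a + i * ((b - a) / N), ⟨by simp, ?_, fun i _ => ?_⟩, fun i _ => ?_⟩
    · field_simp
      ring
    · rw [← sub_pos, hstep]
      exact div_pos (by linarith) hpos
    · simp only [hstep]
      rw [div_lt_iff₀ hη] at hN
      rw [div_le_iff₀ hpos]
      linarith

/-- Two-dimensional sewing: Riemann sums of an almost additive germ converge. -/
theorem RectDefectLE.exists_rConv {s s' t t' K θ₁ θ₂ : ℝ} {F : ℝ → ℝ → ℝ → ℝ → ℝ}
    (h : RectDefectLE s s' t t' K θ₁ θ₂ F) (hK : 0 ≤ K) (hθ₁ : 1 < θ₁) (hθ₂ : 1 < θ₂)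
    (hs : s ≤ s') (ht : t ≤ t') : ∃ L, RConv s s' t t' F L := by
  have cauchy : ∀ ε > (0 : ℝ), ∃ η > (0 : ℝ), ∀ (m n m' n' : ℕ) (σ τ σ' τ' : ℕ → ℝ),
      IsGrid s s' m σ → IsGrid t t' n τ → IsGrid s s' m' σ' → IsGrid t t' n' τ' →
      MeshLE m σ η → MeshLE n τ η → MeshLE m' σ' η → MeshLE n' τ' η →
      |riemannSum F m n σ τ - riemannSum F m' n' σ' τ'| ≤ ε := by
    intro ε hε
    obtain ⟨η₁, p₁, hη₁⟩ := exists_pos_mul_rpow_le (sub_pos.2 hθ₁)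
      (2 * (youngConst θ₁ * (K + youngConst θ₂ * K * (t' - t) ^ θ₂) * (s' - s))) (half_pos hε)
    obtain ⟨η₂, p₂, hη₂⟩ := exists_pos_mul_rpow_le (sub_pos.2 hθ₂)
      (2 * (youngConst θ₂ * (K + youngConst θ₁ * K * (s' - s) ^ θ₁) * (t' - t))) (half_pos hε)
    refine ⟨min η₁ η₂, lt_min p₁ p₂, fun m n m' n' σ τ σ' τ' g₁ g₂ g₁' g₂' q₁ q₂ q₁' q₂' => ?_⟩
    obtain ⟨ρ, hρ, hρ0, hρm, hρη, eρ⟩ := g₁.exists_monotone q₁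
    obtain ⟨ω, hω, hω0, hωn, hωη, eω⟩ := g₂.exists_monotone q₂
    obtain ⟨ρ', hρ', hρ0', hρm', hρη', eρ'⟩ := g₁'.exists_monotone q₁'
    obtain ⟨ω', hω', hω0', hωn', hωη', eω'⟩ := g₂'.exists_monotone q₂'
    rw [← riemannSum_congr F eρ eω, ← riemannSum_congr F eρ' eω']
    have e1 := (h.abs_riemannSum_sub_le hK hθ₁ hθ₂ hρ hω hω' hρ0 hρm hω0 hωn hω0' hωn'
      hωη hωη').trans (hη₂ _ (lt_min p₁ p₂) (min_le_right _ _))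
    have e2 := (h.swap.abs_riemannSum_sub_le hK hθ₂ hθ₁ hω' hρ hρ' hω0' hωn' hρ0 hρm hρ0' hρm'
      hρη hρη').trans (hη₁ _ (lt_min p₁ p₂) (min_le_left _ _))
    rw [riemannSum_swap F, riemannSum_swap F] at e2
    have := (abs_sub_le _ _ _).trans (add_le_add e1 e2)
    linarith
  have hk : ∀ k : ℕ, 0 < 1 / ((k : ℝ) + 1) := fun k => Nat.one_div_pos_of_nat
  choose m σ hσ hmσ using fun k : ℕ => exists_isGrid hs (hk k)
  choose n τ hτ hmτ using fun k : ℕ => exists_isGrid ht (hk k)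
  have fine : ∀ η > (0 : ℝ), ∃ N : ℕ, ∀ k ≥ N, MeshLE (m k) (σ k) η ∧ MeshLE (n k) (τ k) η := by
    intro η hη
    obtain ⟨N, hN⟩ := exists_nat_one_div_lt hη
    refine ⟨N, fun k hNk => ?_⟩
    have := (Nat.one_div_le_one_div hNk).trans hN.le
    exact ⟨fun i hi => (hmσ k i hi).trans this, fun i hi => (hmτ k i hi).trans this⟩
  have hc : CauchySeq fun k => riemannSum F (m k) (n k) (σ k) (τ k) := by
    refine Metric.cauchySeq_iff'.2 fun ε hε => ?_
    obtain ⟨η, hη, H⟩ := cauchy (ε / 2) (half_pos hε)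
    obtain ⟨N, hN⟩ := fine η hη
    refine ⟨N, fun k hk => ?_⟩
    rw [Real.dist_eq]
    have := H _ _ _ _ _ _ _ _ (hσ k) (hτ k) (hσ N) (hτ N) (hN k hk).1 (hN k hk).2
      (hN N le_rfl).1 (hN N le_rfl).2
    linarith
  obtain ⟨L, hL⟩ := cauchySeq_tendsto_of_complete hc
  refine ⟨L, fun ε hε => ?_⟩
  obtain ⟨η, hη, H⟩ := cauchy ε hε
  refine ⟨η, hη, fun m' n' σ' τ' g₁ g₂ q₁ q₂ => ?_⟩
  obtain ⟨N, hN⟩ := fine η hη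
  refine le_of_tendsto ((tendsto_const_nhds.sub hL).abs) ?_
  filter_upwards [Filter.eventually_ge_atTop N] with k hk
  exact H _ _ _ _ _ _ _ _ g₁ g₂ (hσ k) (hτ k) q₁ q₂ (hN k hk).1 (hN k hk).2

theorem abs_sub_le_of_hasDerivAt {f f' : ℝ → ℝ} {K a b : ℝ} (hf : ∀ x, HasDerivAt f (f' x) x)
    (hK : ∀ x ∈ uIcc a b, |f' x| ≤ K) : |f b - f a| ≤ K * |b - a| :=
  (convex_uIcc a b).norm_image_sub_le_of_norm_hasDerivWithin_le
    (fun x _ => (hf x).hasDerivWithinAt) hK left_mem_uIcc right_mem_uIcc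

theorem abs_le_of_mem_uIcc {a b w R : ℝ} (ha : |a| ≤ R) (hb : |b| ≤ R) (hw : w ∈ uIcc a b) :
    |w| ≤ R := by
  rw [abs_le] at *
  rcases mem_uIcc.1 hw with h | h <;> constructor <;> linarith [h.1, h.2, ha.1, ha.2, hb.1, hb.2]

/-- `f` is Lipschitz with constant `M` on `[-R, R]`. -/
def LipOn (R M : ℝ) (f : ℝ → ℝ) : Prop :=
  ∀ y z, |y| ≤ R → |z| ≤ R → |f y - f z| ≤ M * |y - z|

theorem exists_lipOn {f : ℝ → ℝ} (hf : ContDiff ℝ 1 f) (R : ℝ) : ∃ M, 0 ≤ M ∧ LipOn R M f := by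
  obtain ⟨M, hM⟩ := (hf.locallyLipschitz.locallyLipschitzOn
    (s := Icc (-R) R)).exists_lipschitzOnWith_of_compact isCompact_Icc
  refine ⟨M, M.2, fun y z hy hz => ?_⟩
  have := hM.dist_le_mul y (abs_le.1 hy) z (abs_le.1 hz)
  rwa [Real.dist_eq, Real.dist_eq] at this

theorem ContDiff.deriv_of_succ {f : ℝ → ℝ} {n : ℕ} (hf : ContDiff ℝ (n + 1 : ℕ) f) :
    ContDiff ℝ n (deriv f) := by
  push_cast at hf
  exact (contDiff_succ_iff_deriv.1 hf).2.2

theorem ContDiff.hasDerivAt_deriv {f : ℝ → ℝ} {n : ℕ} (hf : ContDiff ℝ (n + 1 : ℕ) f) (x : ℝ) :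
    HasDerivAt f (deriv f x) x :=
  (hf.differentiable (by simp) x).hasDerivAt

/-- First order Taylor remainder of `f` at `y` with increment `p`. -/
noncomputable def taylorRem (f : ℝ → ℝ) (y p : ℝ) : ℝ := f (y + p) - f y - deriv f y * p

theorem abs_add_sub_sub_le {f : ℝ → ℝ} {R M y z p : ℝ}
    (hf : ∀ x, HasDerivAt f (deriv f x) x) (hM : LipOn R M (deriv f))
    (hy : |y| ≤ R) (hz : |z| ≤ R) (hyp : |y + p| ≤ R) (hzp : |z + p| ≤ R) :
    |(f (y + p) - f y) - (f (z + p) - f z)| ≤ M * |p| * |y - z| := by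
  refine abs_sub_le_of_hasDerivAt (f := fun w => f (w + p) - f w)
    (fun w => ((hf (w + p)).comp_add_const w p).sub (hf w)) fun w hw => ?_
  have h1 : |w + p| ≤ R := abs_le_of_mem_uIcc hzp hyp (by
    rcases mem_uIcc.1 hw with h | h
    · exact mem_uIcc.2 (Or.inl ⟨by linarith [h.1], by linarith [h.2]⟩)
    · exact mem_uIcc.2 (Or.inr ⟨by linarith [h.1], by linarith [h.2]⟩))
  simpa using hM (w + p) w h1 (abs_le_of_mem_uIcc hz hy hw)

theorem hasDerivAt_taylorRem {f : ℝ → ℝ} (hf : ∀ x, HasDerivAt f (deriv f x) x) (y q : ℝ) :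
    HasDerivAt (taylorRem f y) (deriv f (y + q) - deriv f y) q := by
  have h1 := (((hf (y + q)).comp_const_add y q).sub_const (f y)).sub
    ((hasDerivAt_id q).const_mul (deriv f y))
  rw [mul_one] at h1
  exact h1

theorem abs_taylorRem_sub_le_increment {f : ℝ → ℝ} {R M y p p' : ℝ}
    (hf : ∀ x, HasDerivAt f (deriv f x) x) (hM0 : 0 ≤ M) (hM : LipOn R M (deriv f))
    (hy : |y| ≤ R) (hyp : |y + p| ≤ R) (hyp' : |y + p'| ≤ R) :
    |taylorRem f y p' - taylorRem f y p| ≤ M * (|p| + |p'|) * |p' - p| := by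
  refine abs_sub_le_of_hasDerivAt (hasDerivAt_taylorRem hf y) fun q hq => ?_
  have h1 : |y + q| ≤ R := abs_le_of_mem_uIcc hyp hyp' (by
    rcases mem_uIcc.1 hq with h | h
    · exact mem_uIcc.2 (Or.inl ⟨by linarith [h.1], by linarith [h.2]⟩)
    · exact mem_uIcc.2 (Or.inr ⟨by linarith [h.1], by linarith [h.2]⟩))
  have h2 : |q| ≤ |p| + |p'| := abs_le_of_mem_uIcc (le_add_of_nonneg_right (abs_nonneg _))
    (le_add_of_nonneg_left (abs_nonneg _)) hq
  have h3 := hM (y + q) y h1 hy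
  rw [add_sub_cancel_left] at h3
  exact h3.trans (mul_le_mul_of_nonneg_left h2 hM0)

theorem abs_taylorRem_le {f : ℝ → ℝ} {R M y p : ℝ}
    (hf : ∀ x, HasDerivAt f (deriv f x) x) (hM0 : 0 ≤ M) (hM : LipOn R M (deriv f))
    (hy : |y| ≤ R) (hyp : |y + p| ≤ R) : |taylorRem f y p| ≤ M * |p| * |p| := by
  have := abs_taylorRem_sub_le_increment (p := 0) (p' := p) hf hM0 hM hy (by simpa using hy) hyp
  simpa [taylorRem] using this

theorem abs_taylorRem_sub_le_point {f : ℝ → ℝ} {R M y y' p : ℝ}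
    (hf : ∀ x, HasDerivAt f (deriv f x) x)
    (hf' : ∀ x, HasDerivAt (deriv f) (deriv (deriv f) x) x) (hM0 : 0 ≤ M)
    (hM : LipOn R M (deriv (deriv f)))
    (hy : |y| ≤ R) (hy' : |y'| ≤ R) (hyp : |y + p| ≤ R) (hyp' : |y' + p| ≤ R) :
    |taylorRem f y' p - taylorRem f y p| ≤ M * |p| * |p| * |y' - y| := by
  refine abs_sub_le_of_hasDerivAt (f := fun w => taylorRem f w p)
    (f' := fun w => taylorRem (deriv f) w p)
    (fun w => (((hf (w + p)).comp_add_const w p).sub (hf w)).sub ((hf' w).mul_const p))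
    fun w hw => ?_
  have h1 : |w + p| ≤ R := abs_le_of_mem_uIcc hyp hyp' (by
    rcases mem_uIcc.1 hw with h | h
    · exact mem_uIcc.2 (Or.inl ⟨by linarith [h.1], by linarith [h.2]⟩)
    · exact mem_uIcc.2 (Or.inr ⟨by linarith [h.1], by linarith [h.2]⟩))
  exact abs_taylorRem_le hf' hM0 hM (abs_le_of_mem_uIcc hy hy' hw) h1

/-- `C` bounds `f` and its increments in the Hölder sense with exponents `ρ₁, ρ₂`. -/
structure HolderBound (ρ₁ ρ₂ C : ℝ) (f : ℝ → ℝ → ℝ) : Prop where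
  dd_le : ∀ s₁ s₂ t₁ t₂ : ℝ, s₁ ∈ Icc (0:ℝ) 1 → s₂ ∈ Icc (0:ℝ) 1 →
    t₁ ∈ Icc (0:ℝ) 1 → t₂ ∈ Icc (0:ℝ) 1 →
    |dd f s₁ s₂ t₁ t₂| ≤ C * |s₂ - s₁| ^ ρ₁ * |t₂ - t₁| ^ ρ₂
  d1_le : ∀ s₁ s₂ t : ℝ, s₁ ∈ Icc (0:ℝ) 1 → s₂ ∈ Icc (0:ℝ) 1 → t ∈ Icc (0:ℝ) 1 →
    |d1 f s₁ s₂ t| ≤ C * |s₂ - s₁| ^ ρ₁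
  d2_le : ∀ s t₁ t₂ : ℝ, s ∈ Icc (0:ℝ) 1 → t₁ ∈ Icc (0:ℝ) 1 → t₂ ∈ Icc (0:ℝ) 1 →
    |d2 f s t₁ t₂| ≤ C * |t₂ - t₁| ^ ρ₂
  abs_le : ∀ s t : ℝ, s ∈ Icc (0:ℝ) 1 → t ∈ Icc (0:ℝ) 1 → |f s t| ≤ C

section HolderBound

variable {ρ₁ ρ₂ C : ℝ} {f : ℝ → ℝ → ℝ}

theorem HolderBound.nonneg (h : HolderBound ρ₁ ρ₂ C f) : 0 ≤ C :=
  (abs_nonneg _).trans (h.abs_le 0 0 (by simp) (by simp))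

theorem HolderBound.mono {C' : ℝ} (h : HolderBound ρ₁ ρ₂ C f) (hC : C ≤ C') :
    HolderBound ρ₁ ρ₂ C' f where
  dd_le s₁ s₂ t₁ t₂ h1 h2 h3 h4 := (h.dd_le s₁ s₂ t₁ t₂ h1 h2 h3 h4).trans (by gcongr)
  d1_le s₁ s₂ t h1 h2 h3 := (h.d1_le s₁ s₂ t h1 h2 h3).trans (by gcongr)
  d2_le s t₁ t₂ h1 h2 h3 := (h.d2_le s t₁ t₂ h1 h2 h3).trans (by gcongr)
  abs_le s t h1 h2 := (h.abs_le s t h1 h2).trans hC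

theorem abs_sub_rpow_le {a b u v ρ : ℝ} (hρ : 0 ≤ ρ) (hu : a ≤ u) (huv : u ≤ v) (hv : v ≤ b) :
    |v - u| ^ ρ ≤ (b - a) ^ ρ :=
  Real.rpow_le_rpow (abs_nonneg _) (by rw [abs_of_nonneg (by linarith)]; linarith) hρ

theorem HolderBound.abs_d1_le (h : HolderBound ρ₁ ρ₂ C f) (hρ₁ : 0 ≤ ρ₁) {a b u v t : ℝ}
    (h0 : 0 ≤ a) (hu : a ≤ u) (huv : u ≤ v) (hv : v ≤ b) (h1 : b ≤ 1) (ht : t ∈ Icc (0:ℝ) 1) :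
    |d1 f u v t| ≤ C * (b - a) ^ ρ₁ :=
  (h.d1_le u v t ⟨by linarith, by linarith⟩ ⟨by linarith, by linarith⟩ ht).trans
    (mul_le_mul_of_nonneg_left (abs_sub_rpow_le hρ₁ hu huv hv) h.nonneg)

theorem HolderBound.abs_d2_le (h : HolderBound ρ₁ ρ₂ C f) (hρ₂ : 0 ≤ ρ₂) {a b u v s : ℝ}
    (h0 : 0 ≤ a) (hu : a ≤ u) (huv : u ≤ v) (hv : v ≤ b) (h1 : b ≤ 1) (hs : s ∈ Icc (0:ℝ) 1) :
    |d2 f s u v| ≤ C * (b - a) ^ ρ₂ :=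
  (h.d2_le s u v hs ⟨by linarith, by linarith⟩ ⟨by linarith, by linarith⟩).trans
    (mul_le_mul_of_nonneg_left (abs_sub_rpow_le hρ₂ hu huv hv) h.nonneg)

theorem HolderBound.abs_dd_le (h : HolderBound ρ₁ ρ₂ C f) (hρ₁ : 0 ≤ ρ₁) (hρ₂ : 0 ≤ ρ₂)
    {a b u v c d w z : ℝ} (h0 : 0 ≤ a) (hu : a ≤ u) (huv : u ≤ v) (hv : v ≤ b) (h1 : b ≤ 1)
    (h0' : 0 ≤ c) (hw : c ≤ w) (hwz : w ≤ z) (hz : z ≤ d) (h1' : d ≤ 1) :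
    |dd f u v w z| ≤ C * (b - a) ^ ρ₁ * (d - c) ^ ρ₂ := by
  refine (h.dd_le u v w z ⟨by linarith, by linarith⟩ ⟨by linarith, by linarith⟩
    ⟨by linarith, by linarith⟩ ⟨by linarith, by linarith⟩).trans ?_
  have e1 := abs_sub_rpow_le hρ₁ hu huv hv
  have e2 := abs_sub_rpow_le hρ₂ hw hwz hz
  have e3 := h.nonneg
  have e4 : 0 ≤ (b - a) ^ ρ₁ := Real.rpow_nonneg (by linarith) _
  gcongr

/-- Composition with a `C²` function preserves Hölder bounds. -/
theorem HolderBound.exists_comp (h : HolderBound ρ₁ ρ₂ C f) {ψ : ℝ → ℝ}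
    (hψ : ContDiff ℝ (2 : ℕ) ψ) : ∃ C', HolderBound ρ₁ ρ₂ C' fun s t => ψ (f s t) := by
  have hC := h.nonneg
  obtain ⟨M₁, hM₁, L₁⟩ := exists_lipOn (hψ.of_le (by norm_num)) (3 * C)
  obtain ⟨M₂, hM₂, L₂⟩ := exists_lipOn (hψ.deriv_of_succ (n := 1)) (3 * C)
  have hR : ∀ s t : ℝ, s ∈ Icc (0:ℝ) 1 → t ∈ Icc (0:ℝ) 1 → |f s t| ≤ 3 * C :=
    fun s t h1 h2 => (h.abs_le s t h1 h2).trans (by linarith)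
  set C' := M₁ * C + M₂ * C * C + (|ψ 0| + M₁ * C) with hC'
  have k1 : 0 ≤ M₁ * C := by positivity
  have k2 : 0 ≤ M₂ * C * C := by positivity
  have k3 := abs_nonneg (ψ 0)
  have hC1 : M₁ * C ≤ C' := by linarith
  refine ⟨C', ?_, ?_, ?_, ?_⟩
  · intro a b c d ha hb hc hd
    have e0 := h.dd_le a b c d ha hb hc hd
    have e1 := h.d1_le a b c ha hb hc
    have e2 := h.d2_le a c d ha hc hd
    have b1 := h.abs_le a d ha hd
    have b2 := h.abs_le b c hb hc
    have b3 := h.abs_le a c ha hc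
    have b4 := hR b d hb hd
    have hA : |f a d + (f b c - f a c)| ≤ 3 * C := by
      rw [_root_.abs_le] at *
      constructor <;> linarith [b1.1, b1.2, b2.1, b2.2, b3.1, b3.2]
    have f1 := L₁ _ _ b4 hA
    have f2 := abs_add_sub_sub_le (y := f a d) (z := f a c) (p := f b c - f a c)
      (hψ.hasDerivAt_deriv (n := 1)) L₂ (hR a d ha hd) (hR a c ha hc) hA
      (by rw [add_sub_cancel]; exact hR b c hb hc)
    rw [add_sub_cancel] at f2
    have g1 : f b d - (f a d + (f b c - f a c)) = dd f a b c d := by unfold dd; ring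
    rw [g1] at f1
    have n1 : 0 ≤ |b - a| ^ ρ₁ := by positivity
    have n2 : 0 ≤ |d - c| ^ ρ₂ := by positivity
    calc |dd (fun s t => ψ (f s t)) a b c d|
        = |(ψ (f b d) - ψ (f a d + (f b c - f a c))) +
          ((ψ (f a d + (f b c - f a c)) - ψ (f a d)) - (ψ (f b c) - ψ (f a c)))| := by
          congr 1; unfold dd; ring
      _ ≤ M₁ * |dd f a b c d| + M₂ * |d1 f a b c| * |d2 f a c d| :=
          (abs_add_le _ _).trans (add_le_add f1 f2)
      _ ≤ M₁ * (C * |b - a| ^ ρ₁ * |d - c| ^ ρ₂) +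
          M₂ * (C * |b - a| ^ ρ₁) * (C * |d - c| ^ ρ₂) := by gcongr
      _ = (M₁ * C + M₂ * C * C) * (|b - a| ^ ρ₁ * |d - c| ^ ρ₂) := by ring
      _ ≤ C' * (|b - a| ^ ρ₁ * |d - c| ^ ρ₂) := by
          gcongr
          linarith
      _ = _ := by ring
  · intro a b t ha hb ht
    calc |d1 (fun s t => ψ (f s t)) a b t| ≤ M₁ * |d1 f a b t| :=
          L₁ _ _ (hR b t hb ht) (hR a t ha ht)
      _ ≤ M₁ * (C * |b - a| ^ ρ₁) := by gcongr; exact h.d1_le a b t ha hb ht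
      _ = M₁ * C * |b - a| ^ ρ₁ := by ring
      _ ≤ _ := by gcongr
  · intro s c d hs hc hd
    calc |d2 (fun s t => ψ (f s t)) s c d| ≤ M₁ * |d2 f s c d| :=
          L₁ _ _ (hR s d hs hd) (hR s c hs hc)
      _ ≤ M₁ * (C * |d - c| ^ ρ₂) := by gcongr; exact h.d2_le s c d hs hc hd
      _ = M₁ * C * |d - c| ^ ρ₂ := by ring
      _ ≤ _ := by gcongr
  · intro s t hs ht
    have e1 := L₁ (f s t) 0 (hR s t hs ht) (by simp [hC])
    rw [sub_zero] at e1
    have e2 : M₁ * |f s t| ≤ M₁ * C := mul_le_mul_of_nonneg_left (h.abs_le s t hs ht) hM₁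
    have e3 := abs_sub_abs_le_abs_sub (ψ (f s t)) (ψ 0)
    show |ψ (f s t)| ≤ C'
    linarith

end HolderBound

theorem rpow_add_self {h ρ : ℝ} (hh : 0 ≤ h) (hρ : 0 ≤ ρ) : h ^ (ρ + ρ) = h ^ ρ * h ^ ρ :=
  Real.rpow_add_of_nonneg hh hρ hρ

theorem side_rpow {a b ρ : ℝ} (h0 : 0 ≤ a) (hab : a ≤ b) (h1 : b ≤ 1) (hρ : 0 ≤ ρ) :
    0 ≤ (b - a) ^ ρ ∧ (b - a) ^ ρ ≤ 1 :=
  ⟨Real.rpow_nonneg (by linarith) _,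
    Real.rpow_le_one (by linarith) (by linarith) hρ⟩

section Germs

variable {α β C : ℝ} {x y : ℝ → ℝ → ℝ} {s s' t t' : ℝ}

/-- The germ of the double Young integral `∬ y dx`. -/
theorem HolderBound.rectDefectLE_mul_dd (hα : 0 ≤ α) (hβ : 0 ≤ β) (hx : HolderBound α β C x)
    (hy : HolderBound α β C y) (hs : 0 ≤ s) (hs' : s' ≤ 1) (ht : 0 ≤ t) (ht' : t' ≤ 1) :
    RectDefectLE s s' t t' (C * C) (α + α) (β + β) fun a b c d => y a c * dd x a b c d where
  left c d h1 h2 h3 a m b h4 h5 h6 h7 := by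
    have hC := hx.nonneg
    obtain ⟨H0, H1⟩ := side_rpow (hs.trans h4) (h5.trans h6) (h7.trans hs') hα
    obtain ⟨k0, k1⟩ := side_rpow (ht.trans h1) h2 (h3.trans ht') hβ
    have e1 := hy.abs_d1_le hα (hs.trans h4) le_rfl h5 h6 (h7.trans hs') (t := c)
      ⟨by linarith, by linarith⟩
    have e2 := hx.abs_dd_le hα hβ (hs.trans h4) h5 h6 le_rfl (h7.trans hs')
      (ht.trans h1) le_rfl h2 le_rfl (h3.trans ht')
    rw [rpow_add_self (by linarith) hα]
    set H := (b - a) ^ α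
    set k := (d - c) ^ β
    calc _ = |d1 y a m c| * |dd x m b c d| := by
          rw [← abs_mul, ← abs_neg]
          congr 1; unfold d1 dd; ring
      _ ≤ (C * H) * (C * H * k) := by gcongr
      _ = C * C * (H * H) * k := by ring
      _ ≤ C * C * (H * H) := mul_le_of_le_one_right (by positivity) k1
  right a b h1 h2 h3 c n d h4 h5 h6 h7 := by
    have hC := hx.nonneg
    obtain ⟨H0, H1⟩ := side_rpow (hs.trans h1) h2 (h3.trans hs') hα
    obtain ⟨k0, k1⟩ := side_rpow (ht.trans h4) (h5.trans h6) (h7.trans ht') hβ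
    have e1 := hy.abs_d2_le hβ (ht.trans h4) le_rfl h5 h6 (h7.trans ht') (s := a)
      ⟨by linarith, by linarith⟩
    have e2 := hx.abs_dd_le hα hβ (hs.trans h1) le_rfl h2 le_rfl (h3.trans hs')
      (ht.trans h4) h5 h6 le_rfl (h7.trans ht')
    rw [rpow_add_self (by linarith) hβ]
    set H := (b - a) ^ α
    set k := (d - c) ^ β
    calc _ = |d2 y a c n| * |dd x a b n d| := by
          rw [← abs_mul, ← abs_neg]
          congr 1; unfold d2 dd; ring
      _ ≤ (C * k) * (C * H * k) := by gcongr
      _ = C * C * (k * k) * H := by ring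
      _ ≤ C * C * (k * k) := mul_le_of_le_one_right (by positivity) H1
  mixed c n d h1 h2 h3 h4 a m b h5 h6 h7 h8 := by
    have hC := hx.nonneg
    obtain ⟨H0, H1⟩ := side_rpow (hs.trans h5) (h6.trans h7) (h8.trans hs') hα
    obtain ⟨k0, k1⟩ := side_rpow (ht.trans h1) (h2.trans h3) (h4.trans ht') hβ
    have e1 := hy.abs_dd_le hα hβ (hs.trans h5) le_rfl h6 h7 (h8.trans hs')
      (ht.trans h1) le_rfl h2 h3 (h4.trans ht')
    have e2 := hx.abs_dd_le hα hβ (hs.trans h5) h6 h7 le_rfl (h8.trans hs')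
      (ht.trans h1) h2 h3 le_rfl (h4.trans ht')
    rw [rpow_add_self (by linarith) hβ, rpow_add_self (by linarith) hα]
    set H := (b - a) ^ α
    set k := (d - c) ^ β
    calc _ = |dd y a m c n| * |dd x m b n d| := by
          rw [← abs_mul]
          congr 1; unfold dd; ring
      _ ≤ (C * H * k) * (C * H * k) := by gcongr
      _ = C * C * (k * k) * (H * H) := by ring

/-- The germ of the mixed Young integral `∬ y d₁x d₂x`. -/
theorem HolderBound.rectDefectLE_mul_d1_mul_d2 (hα : 0 ≤ α) (hβ : 0 ≤ β)
    (hx : HolderBound α β C x) (hy : HolderBound α β C y) (hs : 0 ≤ s) (hs' : s' ≤ 1)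
    (ht : 0 ≤ t) (ht' : t' ≤ 1) :
    RectDefectLE s s' t t' (4 * (C * C * C)) (α + α) (β + β)
      fun a b c d => y a c * (d1 x a b c * d2 x a c d) where
  left c d h1 h2 h3 a m b h4 h5 h6 h7 := by
    have hC := hx.nonneg
    obtain ⟨H0, H1⟩ := side_rpow (hs.trans h4) (h5.trans h6) (h7.trans hs') hα
    obtain ⟨k0, k1⟩ := side_rpow (ht.trans h1) h2 (h3.trans ht') hβ
    have hc : c ∈ Icc (0:ℝ) 1 := ⟨by linarith, by linarith⟩
    have e1 := hx.abs_d1_le hα (hs.trans h4) h5 h6 le_rfl (h7.trans hs') hc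
    have e2 := hy.abs_d1_le hα (hs.trans h4) le_rfl h5 h6 (h7.trans hs') hc
    have e3 := hx.abs_d2_le hβ (ht.trans h1) le_rfl h2 le_rfl (h3.trans ht') (s := m)
      ⟨by linarith, by linarith⟩
    have e4 := hx.abs_dd_le hα hβ (hs.trans h4) le_rfl h5 h6 (h7.trans hs')
      (ht.trans h1) le_rfl h2 le_rfl (h3.trans ht')
    have e5 := hy.abs_le a c ⟨by linarith, by linarith⟩ hc
    rw [rpow_add_self (by linarith) hα]
    set H := (b - a) ^ α
    set k := (d - c) ^ β
    calc _ = |d1 x m b c * (d1 y a m c * d2 x m c d + y a c * dd x a m c d)| := by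
          rw [← abs_neg]
          congr 1; unfold d1 d2 dd; ring
      _ ≤ |d1 x m b c| * (|d1 y a m c| * |d2 x m c d| + |y a c| * |dd x a m c d|) := by
          rw [abs_mul]
          refine mul_le_mul_of_nonneg_left ?_ (abs_nonneg _)
          rw [← abs_mul, ← abs_mul]
          exact abs_add_le _ _
      _ ≤ (C * H) * ((C * H) * (C * k) + C * (C * H * k)) := by gcongr
      _ = 2 * (C * C * C) * (H * H) * k := by ring
      _ ≤ 2 * (C * C * C) * (H * H) := mul_le_of_le_one_right (by positivity) k1
      _ ≤ 4 * (C * C * C) * (H * H) := by gcongr; norm_num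
  right a b h1 h2 h3 c n d h4 h5 h6 h7 := by
    have hC := hx.nonneg
    obtain ⟨H0, H1⟩ := side_rpow (hs.trans h1) h2 (h3.trans hs') hα
    obtain ⟨k0, k1⟩ := side_rpow (ht.trans h4) (h5.trans h6) (h7.trans ht') hβ
    have ha : a ∈ Icc (0:ℝ) 1 := ⟨by linarith, by linarith⟩
    have e1 := hx.abs_d2_le hβ (ht.trans h4) h5 h6 le_rfl (h7.trans ht') ha
    have e2 := hy.abs_d2_le hβ (ht.trans h4) le_rfl h5 h6 (h7.trans ht') ha
    have e3 := hx.abs_d1_le hα (hs.trans h1) le_rfl h2 le_rfl (h3.trans hs') (t := n)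
      ⟨by linarith, by linarith⟩
    have e4 := hx.abs_dd_le hα hβ (hs.trans h1) le_rfl h2 le_rfl (h3.trans hs')
      (ht.trans h4) le_rfl h5 h6 (h7.trans ht')
    have e5 := hy.abs_le a c ha ⟨by linarith, by linarith⟩
    rw [rpow_add_self (by linarith) hβ]
    set H := (b - a) ^ α
    set k := (d - c) ^ β
    calc _ = |d2 x a n d * (d2 y a c n * d1 x a b n + y a c * dd x a b c n)| := by
          rw [← abs_neg]
          congr 1; unfold d1 d2 dd; ring
      _ ≤ |d2 x a n d| * (|d2 y a c n| * |d1 x a b n| + |y a c| * |dd x a b c n|) := by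
          rw [abs_mul]
          refine mul_le_mul_of_nonneg_left ?_ (abs_nonneg _)
          rw [← abs_mul, ← abs_mul]
          exact abs_add_le _ _
      _ ≤ (C * k) * ((C * k) * (C * H) + C * (C * H * k)) := by gcongr
      _ = 2 * (C * C * C) * (k * k) * H := by ring
      _ ≤ 2 * (C * C * C) * (k * k) := mul_le_of_le_one_right (by positivity) H1
      _ ≤ 4 * (C * C * C) * (k * k) := by gcongr; norm_num
  mixed c n d h1 h2 h3 h4 a m b h5 h6 h7 h8 := by
    have hC := hx.nonneg
    obtain ⟨H0, H1⟩ := side_rpow (hs.trans h5) (h6.trans h7) (h8.trans hs') hα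
    obtain ⟨k0, k1⟩ := side_rpow (ht.trans h1) (h2.trans h3) (h4.trans ht') hβ
    have s0 := hs.trans h5
    have s1 := h8.trans hs'
    have t0 := ht.trans h1
    have t1 := h4.trans ht'
    have ha : a ∈ Icc (0:ℝ) 1 := ⟨by linarith, by linarith⟩
    have hm : m ∈ Icc (0:ℝ) 1 := ⟨by linarith, by linarith⟩
    have hc : c ∈ Icc (0:ℝ) 1 := ⟨by linarith, by linarith⟩
    have hn : n ∈ Icc (0:ℝ) 1 := ⟨by linarith, by linarith⟩
    have e1 := hx.abs_dd_le hα hβ s0 h6 h7 le_rfl s1 t0 le_rfl h2 h3 t1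
    have e2 := hy.abs_d1_le hα s0 le_rfl h6 h7 s1 hn
    have e3 := hx.abs_d1_le hα s0 h6 h7 le_rfl s1 hc
    have e4 := hy.abs_dd_le hα hβ s0 le_rfl h6 h7 s1 t0 le_rfl h2 h3 t1
    have e5 := hx.abs_d2_le hβ t0 h2 h3 le_rfl t1 hm
    have e6 := hy.abs_le a n ha hn
    have e7 := hy.abs_d2_le hβ t0 le_rfl h2 h3 t1 ha
    have e8 := hx.abs_dd_le hα hβ s0 le_rfl h6 h7 s1 t0 h2 h3 le_rfl t1
    rw [rpow_add_self (by linarith) hβ, rpow_add_self (by linarith) hα]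
    set H := (b - a) ^ α
    set k := (d - c) ^ β
    calc _ = |(dd x m b c n * d1 y a m n + d1 x m b c * dd y a m c n) * d2 x m n d +
            (dd x m b c n * y a n + d1 x m b c * d2 y a c n) * dd x a m n d| := by
          congr 1; unfold d1 d2 dd; ring
      _ ≤ (|dd x m b c n| * |d1 y a m n| + |d1 x m b c| * |dd y a m c n|) * |d2 x m n d| +
            (|dd x m b c n| * |y a n| + |d1 x m b c| * |d2 y a c n|) * |dd x a m n d| := by
          refine (abs_add_le _ _).trans ?_
          rw [abs_mul, abs_mul (_ + _)]
          simp only [← abs_mul (dd x m b c n), ← abs_mul (d1 x m b c)]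
          gcongr <;> exact abs_add_le _ _
      _ ≤ ((C * H * k) * (C * H) + (C * H) * (C * H * k)) * (C * k) +
            ((C * H * k) * C + (C * H) * (C * k)) * (C * H * k) := by gcongr
      _ = 4 * (C * C * C) * (k * k) * (H * H) := by ring

end Germs

/-- The part of the increment of `φ ∘ x` over a rectangle not captured by the two germs. -/
noncomputable def chainRem (φ : ℝ → ℝ) (x : ℝ → ℝ → ℝ) (a b c d : ℝ) : ℝ :=
  dd (fun u v => φ (x u v)) a b c d - deriv φ (x a c) * dd x a b c d -
    deriv (deriv φ) (x a c) * (d1 x a b c * d2 x a c d)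

/-- Sums of the chain rule remainder over a strip `[a,b] × [t,t']` are of order `(b - a) ^ (2α)`,
up to an error vanishing with the mesh of the partition of `[t,t']`. -/
theorem HolderBound.exists_abs_sum_chainRem_le {α β C : ℝ} {x : ℝ → ℝ → ℝ} {φ : ℝ → ℝ}
    (hα : 1 / 2 < α) (hβ : 1 / 2 < β) (hx : HolderBound α β C x) (hφ : ContDiff ℝ (4 : ℕ) φ)
    {t t' : ℝ} (ht : 0 ≤ t) (ht' : t' ≤ 1) :
    ∃ K K' : ℝ, 0 ≤ K ∧ 0 ≤ K' ∧ ∀ a b η : ℝ, 0 ≤ a → a ≤ b → b ≤ 1 → 0 ≤ η → ∀ (n : ℕ) (τ : ℕ → ℝ),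
      Monotone τ → τ 0 = t → τ n = t' → MeshLE n τ η →
      |∑ j ∈ Finset.range n, chainRem φ x a b (τ j) (τ (j + 1))| ≤
        K * (b - a) ^ (α + α) + K' * η ^ (β + β - 1) := by
  have hα0 : 0 ≤ α := by linarith
  have hβ0 : 0 ≤ β := by linarith
  have hθ : 1 < β + β := by linarith
  have hC := hx.nonneg
  have hφ' : ContDiff ℝ (3 : ℕ) (deriv φ) := hφ.deriv_of_succ (n := 3)
  have hφ'' : ContDiff ℝ (2 : ℕ) (deriv (deriv φ)) := hφ'.deriv_of_succ (n := 2)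
  obtain ⟨D, hy⟩ := hx.exists_comp (hφ'.of_le (by norm_num))
  have hD := hy.nonneg
  obtain ⟨M₁, hM₁, L₁⟩ := exists_lipOn (hφ'.of_le (by norm_num)) (3 * C)
  obtain ⟨M₂, hM₂, L₂⟩ := exists_lipOn (hφ''.of_le (by norm_num)) (3 * C)
  obtain ⟨M₃, hM₃, L₃⟩ := exists_lipOn (hφ''.deriv_of_succ (n := 1)) (3 * C)
  have d0 : ∀ w, HasDerivAt φ (deriv φ w) w := hφ.hasDerivAt_deriv (n := 3)
  have dd1 : ∀ w, HasDerivAt (deriv φ) (deriv (deriv φ) w) w := hφ'.hasDerivAt_deriv (n := 2)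
  have dd2 : ∀ w, HasDerivAt (deriv (deriv φ)) (deriv (deriv (deriv φ)) w) w :=
    hφ''.hasDerivAt_deriv (n := 1)
  have hR : ∀ u v : ℝ, u ∈ Icc (0:ℝ) 1 → v ∈ Icc (0:ℝ) 1 → |x u v| ≤ 3 * C :=
    fun u v h1 h2 => (hx.abs_le u v h1 h2).trans (by linarith)
  set K₀ := D * C + (M₃ * C * C * C + M₂ * (C + C) * C) * C with hK₀
  set K₁ := D * C + M₂ * C * C * C with hK₁
  have hK₀' : 0 ≤ K₀ := by positivity
  have hK₁' : 0 ≤ K₁ := by positivity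
  have hY := (youngConst_pos hθ).le
  refine ⟨youngConst (β + β) * K₀ + K₁, 2 * (M₁ * C * C), by positivity, by positivity,
    fun a b η ha hab hb hη n τ hτ hτ0 hτn hmesh => ?_⟩
  have htt' : t ≤ t' := hτ0 ▸ hτn ▸ hτ n.zero_le
  have hab' : 0 ≤ b - a := by linarith
  have ia : a ∈ Icc (0:ℝ) 1 := ⟨by linarith, by linarith⟩
  have ib : b ∈ Icc (0:ℝ) 1 := ⟨by linarith, by linarith⟩
  obtain ⟨H0, H1⟩ := side_rpow ha hab hb hα0
  rw [rpow_add_self hab' hα0]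
  set H := (b - a) ^ α with hH
  set U : ℝ → ℝ := fun c => deriv φ (x b c) - deriv φ (x a c) with hU
  set V : ℝ → ℝ := fun c => taylorRem (deriv φ) (x a c) (d1 x a b c) with hV
  set Ξ : ℝ → ℝ → ℝ := fun c d => U c * dd x a b c d + V c * d2 x a c d with hΞ
  have hrow : ∀ c, x a c + d1 x a b c = x b c := fun c => by unfold d1; ring
  have hcol : ∀ u c d, x u c + d2 x u c d = x u d := fun u c d => by unfold d2; ring
  have hdef : DefectLE t t' (K₀ * (H * H)) (β + β) Ξ := by
    intro c n d h1 h2 h3 h4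
    have t0 := ht.trans h1
    have t1 := h4.trans ht'
    obtain ⟨k0, k1⟩ := side_rpow t0 (h2.trans h3) t1 hβ0
    have ic : c ∈ Icc (0:ℝ) 1 := ⟨by linarith, by linarith⟩
    have iN : n ∈ Icc (0:ℝ) 1 := ⟨by linarith, by linarith⟩
    have e1 := hy.abs_dd_le hα0 hβ0 ha le_rfl hab le_rfl hb t0 le_rfl h2 h3 t1
    have e2 := hx.abs_dd_le hα0 hβ0 ha le_rfl hab le_rfl hb t0 h2 h3 le_rfl t1
    have e3 := hx.abs_d2_le hβ0 t0 h2 h3 le_rfl t1 ia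
    have e4 := hx.abs_d2_le hβ0 t0 le_rfl h2 h3 t1 ia
    have e5 := hx.abs_d1_le hα0 ha le_rfl hab le_rfl hb ic
    have e6 := hx.abs_d1_le hα0 ha le_rfl hab le_rfl hb iN
    have e7 := hx.abs_dd_le hα0 hβ0 ha le_rfl hab le_rfl hb t0 le_rfl h2 h3 t1
    have hx3 : |x a n + d1 x a b c| ≤ 3 * C := by
      have b1 := hx.abs_le a n ia iN
      have b2 := hx.abs_le b c ib ic
      have b3 := hx.abs_le a c ia ic
      unfold d1
      rw [_root_.abs_le] at *
      constructor <;> linarith [b1.1, b1.2, b2.1, b2.2, b3.1, b3.2]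
    have v1 := abs_taylorRem_sub_le_point dd1 dd2 hM₃ L₃ (hR a c ia ic) (hR a n ia iN)
      (by rw [hrow]; exact hR b c ib ic) hx3
    have v2 := abs_taylorRem_sub_le_increment (p' := d1 x a b n) dd1 hM₂ L₂ (hR a n ia iN) hx3
      (by rw [hrow]; exact hR b n ib iN)
    rw [rpow_add_self (by linarith) hβ0]
    set k := (d - c) ^ β
    have w2 : d1 x a b n - d1 x a b c = dd x a b c n := by unfold d1 dd; ring
    rw [w2] at v2
    have hVd : |V n - V c| ≤ (M₃ * C * C * C + M₂ * (C + C) * C) * (H * H) * k := by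
      calc |V n - V c| ≤ M₂ * (|d1 x a b c| + |d1 x a b n|) * |dd x a b c n| +
            M₃ * |d1 x a b c| * |d1 x a b c| * |d2 x a c n| :=
          (abs_sub_le _ _ _).trans (add_le_add v2 v1)
        _ ≤ M₂ * (C * H + C * H) * (C * H * k) + M₃ * (C * H) * (C * H) * (C * k) := by gcongr
        _ = _ := by ring
    calc |Ξ c d - Ξ c n - Ξ n d| =
          |dd (fun u v => deriv φ (x u v)) a b c n * dd x a b n d + (V n - V c) * d2 x a n d| := by
          rw [← abs_neg]
          congr 1; simp only [hΞ, hU]; unfold d2 dd; ring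
      _ ≤ |dd (fun u v => deriv φ (x u v)) a b c n| * |dd x a b n d| +
          |V n - V c| * |d2 x a n d| := by
          rw [← abs_mul, ← abs_mul]
          exact abs_add_le _ _
      _ ≤ (D * H * k) * (C * H * k) +
          ((M₃ * C * C * C + M₂ * (C + C) * C) * (H * H) * k) * (C * k) := by gcongr
      _ = K₀ * (H * H) * (k * k) := by rw [hK₀]; ring
  have hΞ0 : |Ξ t t'| ≤ K₁ * (H * H) := by
    have it : t ∈ Icc (0:ℝ) 1 := ⟨by linarith, by linarith⟩
    obtain ⟨k0, k1⟩ := side_rpow ht htt' ht' hβ0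
    have e1 : |U t| ≤ D * H := hy.abs_d1_le hα0 ha le_rfl hab le_rfl hb it
    have e2 := hx.abs_dd_le hα0 hβ0 ha le_rfl hab le_rfl hb ht le_rfl htt' le_rfl ht'
    have e3 := hx.abs_d2_le hβ0 ht le_rfl htt' le_rfl ht' ia
    have e4 := hx.abs_d1_le hα0 ha le_rfl hab le_rfl hb it
    have e5 : |V t| ≤ M₂ * |d1 x a b t| * |d1 x a b t| :=
      abs_taylorRem_le dd1 hM₂ L₂ (hR a t ia it) (by rw [hrow]; exact hR b t ib it)
    set k := (t' - t) ^ β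
    calc |Ξ t t'| ≤ |U t| * |dd x a b t t'| + |V t| * |d2 x a t t'| := by
          rw [← abs_mul, ← abs_mul]
          exact abs_add_le _ _
      _ ≤ (D * H) * (C * H * k) + (M₂ * |d1 x a b t| * |d1 x a b t|) * (C * k) := by gcongr
      _ ≤ (D * H) * (C * H * k) + (M₂ * (C * H) * (C * H)) * (C * k) := by gcongr
      _ = K₁ * (H * H) * k := by rw [hK₁]; ring
      _ ≤ K₁ * (H * H) := mul_le_of_le_one_right (by positivity) k1
  have hsum := hdef.abs_sum_sub_le (by positivity) hθ hτ hτ0.ge hτn.le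
  rw [hτ0, hτn] at hsum
  have hunit : (t' - t) ^ (β + β) ≤ 1 := (side_rpow ht htt' ht' (by linarith)).2
  have hsum' : |∑ j ∈ Finset.range n, Ξ (τ j) (τ (j + 1))| ≤
      (youngConst (β + β) * K₀ + K₁) * (H * H) := by
    have e1 := (abs_add_le _ _).trans (add_le_add hsum hΞ0)
    rw [sub_add_cancel] at e1
    refine e1.trans ?_
    have := mul_le_of_le_one_right (a := youngConst (β + β) * (K₀ * (H * H))) (by positivity) hunit
    linarith
  have hlocal : ∀ j ∈ Finset.range n,
      |chainRem φ x a b (τ j) (τ (j + 1)) - Ξ (τ j) (τ (j + 1))| ≤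
        2 * (M₁ * C * C) * (τ (j + 1) - τ j) ^ (β + β) := by
    intro j hj
    have hj : j < n := Finset.mem_range.1 hj
    have m1 : t ≤ τ j := hτ0 ▸ hτ j.zero_le
    have m2 : τ j ≤ τ (j + 1) := hτ j.le_succ
    have m3 : τ (j + 1) ≤ t' := hτn ▸ hτ hj
    generalize τ j = c at *
    generalize τ (j + 1) = d at *
    have ic : c ∈ Icc (0:ℝ) 1 := ⟨by linarith, by linarith⟩
    have id : d ∈ Icc (0:ℝ) 1 := ⟨by linarith, by linarith⟩
    have row : ∀ u ∈ Icc (0:ℝ) 1, |taylorRem φ (x u c) (d2 x u c d)| ≤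
        M₁ * (C * (d - c) ^ β) * (C * (d - c) ^ β) := fun u iu => by
      have e1 := abs_taylorRem_le d0 hM₁ L₁ (hR u c iu ic) (p := d2 x u c d)
        (by rw [hcol]; exact hR u d iu id)
      have e2 := hx.abs_d2_le hβ0 (ht.trans m1) le_rfl m2 le_rfl (m3.trans ht') iu
      exact e1.trans (by gcongr)
    rw [rpow_add_self (by linarith) hβ0]
    have hid : chainRem φ x a b c d - Ξ c d =
        taylorRem φ (x b c) (d2 x b c d) - taylorRem φ (x a c) (d2 x a c d) := by
      simp only [hΞ, hU, hV, chainRem, taylorRem, hrow, hcol]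
      unfold d1 d2 dd
      ring
    rw [hid]
    have := (abs_sub _ _).trans (add_le_add (row b ib) (row a ia))
    refine this.trans (le_of_eq (by ring))
  have herr : |∑ j ∈ Finset.range n,
      (chainRem φ x a b (τ j) (τ (j + 1)) - Ξ (τ j) (τ (j + 1)))| ≤
        2 * (M₁ * C * C) * η ^ (β + β - 1) := by
    refine (Finset.abs_sum_le_sum_abs _ _).trans ((Finset.sum_le_sum hlocal).trans ?_)
    rw [← Finset.mul_sum]
    refine mul_le_mul_of_nonneg_left ?_ (by positivity)
    refine (sum_increment_rpow_le hθ hτ hmesh).trans ?_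
    rw [hτ0, hτn]
    exact mul_le_of_le_one_right (Real.rpow_nonneg hη _) (by linarith)
  have := (abs_add_le _ _).trans (add_le_add hsum' herr)
  rw [← Finset.sum_add_distrib] at this
  simpa only [add_sub_cancel] using this

theorem riemannSum_dd (f : ℝ → ℝ → ℝ) (m n : ℕ) (σ τ : ℕ → ℝ) :
    riemannSum (dd f) m n σ τ = dd f (σ 0) (σ m) (τ 0) (τ n) := by
  have h1 : ∀ a b, ∑ j ∈ Finset.range n, dd f a b (τ j) (τ (j + 1)) = dd f a b (τ 0) (τ n) := by
    intro a b
    have := Finset.sum_range_sub (fun j => f b (τ j) - f a (τ j)) n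
    calc _ = _ := Finset.sum_congr rfl fun j _ => by unfold dd; ring
      _ = _ := this
      _ = _ := by unfold dd; ring
  unfold riemannSum
  simp only [h1]
  have := Finset.sum_range_sub (fun i => f (σ i) (τ n) - f (σ i) (τ 0)) m
  calc _ = _ := Finset.sum_congr rfl fun j _ => by unfold dd; ring
    _ = _ := this
    _ = _ := by unfold dd; ring

/-- Riemann sums of the chain rule remainder are small along suitable arbitrarily fine grids. -/
theorem HolderBound.exists_riemannSum_chainRem_le {α β C : ℝ} {x : ℝ → ℝ → ℝ} {φ : ℝ → ℝ}
    (hα : 1 / 2 < α) (hβ : 1 / 2 < β) (hx : HolderBound α β C x) (hφ : ContDiff ℝ (4 : ℕ) φ)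
    {s s' t t' : ℝ} (hs : 0 ≤ s) (hss' : s ≤ s') (hs' : s' ≤ 1) (ht : 0 ≤ t) (htt' : t ≤ t')
    (ht' : t' ≤ 1) {ε η : ℝ} (hε : 0 < ε) (hη : 0 < η) :
    ∃ m n σ τ, IsGrid s s' m σ ∧ IsGrid t t' n τ ∧ MeshLE m σ η ∧ MeshLE n τ η ∧
      |riemannSum (chainRem φ x) m n σ τ| ≤ ε := by
  obtain ⟨K, K', hK, hK', hstrip⟩ := hx.exists_abs_sum_chainRem_le hα hβ hφ ht ht'
  obtain ⟨η₁, p₁, hη₁⟩ := exists_pos_mul_rpow_le (p := α + α - 1) (by linarith) K (half_pos hε)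
  have q₁ := lt_min hη p₁
  obtain ⟨m, σ, gσ, mσ⟩ := exists_isGrid hss' q₁
  obtain ⟨η₂, p₂, hη₂⟩ := exists_pos_mul_rpow_le (p := β + β - 1) (by linarith) (m * K')
    (half_pos hε)
  have q₂ := lt_min hη p₂
  obtain ⟨n, τ, gτ, mτ⟩ := exists_isGrid htt' q₂
  refine ⟨m, n, σ, τ, gσ, gτ, fun i hi => (mσ i hi).trans (min_le_left _ _),
    fun i hi => (mτ i hi).trans (min_le_left _ _), ?_⟩
  obtain ⟨ρ, hρ, hρ0, hρm, hρη, eρ⟩ := gσ.exists_monotone mσ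
  obtain ⟨ω, hω, hω0, hωn, hωη, eω⟩ := gτ.exists_monotone mτ
  rw [← riemannSum_congr _ eρ eω]
  have hrow : ∀ i ∈ Finset.range m,
      |∑ j ∈ Finset.range n, chainRem φ x (ρ i) (ρ (i + 1)) (ω j) (ω (j + 1))| ≤
        K * (ρ (i + 1) - ρ i) ^ (α + α) + K' * (min η η₂) ^ (β + β - 1) := fun i hi =>
    hstrip _ _ _ (hs.trans (hρ0 ▸ hρ i.zero_le)) (hρ i.le_succ)
      ((hρm ▸ hρ (Finset.mem_range.1 hi) : ρ (i + 1) ≤ s').trans hs') q₂.le n ω hω hω0 hωn hωη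
  refine (Finset.abs_sum_le_sum_abs _ _).trans ((Finset.sum_le_sum hrow).trans ?_)
  rw [Finset.sum_add_distrib, ← Finset.mul_sum, Finset.sum_const, Finset.card_range,
    nsmul_eq_mul, ← mul_assoc]
  have e1 := sum_increment_rpow_le (θ := α + α) (by linarith) hρ hρη
  rw [hρ0, hρm] at e1
  have e2 : (min η η₁) ^ (α + α - 1) * (s' - s) ≤ (min η η₁) ^ (α + α - 1) :=
    mul_le_of_le_one_right (Real.rpow_nonneg q₁.le _) (by linarith)
  have e3 := mul_le_mul_of_nonneg_left (e1.trans e2) hK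
  have e4 := hη₁ _ q₁ (min_le_right _ _)
  have e5 := hη₂ _ q₂ (min_le_right _ _)
  linarith

/-- **Two-dimensional Stratonovich–Young change of variables formula.**
For `1/2 < α,β ≤ 1`, `x` continuous on `[0,1]²` with `𝒩_{α,β}(x) < ∞`, and `φ ∈ C⁴(ℝ)`,
the Riemann sums defining `I₁ = ∬ φ′(x) dx` and `I₂ = ∬ φ″(x) d₁x d₂x` converge on every
rectangle `[s,s']×[t,t'] ⊆ [0,1]²`, and `δ(φ∘x)(s,s';t,t') = I₁ + I₂`. -/
theorem stmt0
    (α β : ℝ) (hα : 1/2 < α) (hα1 : α ≤ 1) (hβ : 1/2 < β) (hβ1 : β ≤ 1)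
    (x : ℝ → ℝ → ℝ)
    (hxc : ContinuousOn (fun q : ℝ × ℝ => x q.1 q.2) (Icc 0 1 ×ˢ Icc 0 1))
    (hxN : NFin α β x)
    (φ : ℝ → ℝ) (hφ : ContDiff ℝ 4 φ)
    (s s' t t' : ℝ) (hs : 0 ≤ s) (hss' : s ≤ s') (hs' : s' ≤ 1)
    (ht : 0 ≤ t) (htt' : t ≤ t') (ht' : t' ≤ 1) :
    ∃ I₁ I₂ : ℝ,
      RConv s s' t t'
        (fun a b c d => deriv φ (x a c) * dd x a b c d) I₁ ∧
      RConv s s' t t'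
        (fun a b c d => deriv (deriv φ) (x a c) * (d1 x a b c * d2 x a c d)) I₂ ∧
      dd (fun u v => φ (x u v)) s s' t t' = I₁ + I₂ := by
  obtain ⟨C, c1, c2, c3, c4⟩ := hxN
  have hx : HolderBound α β C x := ⟨c1, c2, c3, c4⟩
  have hφ4 : ContDiff ℝ (4 : ℕ) φ := hφ
  have hφ' : ContDiff ℝ (3 : ℕ) (deriv φ) := hφ4.deriv_of_succ (n := 3)
  have hφ'' : ContDiff ℝ (2 : ℕ) (deriv (deriv φ)) := hφ'.deriv_of_succ (n := 2)
  obtain ⟨C₁, hy⟩ := hx.exists_comp (hφ'.of_le (by norm_num))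
  obtain ⟨C₂, hz⟩ := hx.exists_comp hφ''
  have hα0 : 0 ≤ α := by linarith
  have hβ0 : 0 ≤ β := by linarith
  have hxB := hx.mono (le_max_left C (max C₁ C₂))
  have hyB := hy.mono ((le_max_left C₁ C₂).trans (le_max_right C _))
  have hzB := hz.mono ((le_max_right C₁ C₂).trans (le_max_right C _))
  have hB := hxB.nonneg
  obtain ⟨I₁, h₁⟩ := (hxB.rectDefectLE_mul_dd hα0 hβ0 hyB hs hs' ht ht').exists_rConv
    (by positivity) (by linarith) (by linarith) hss' htt'
  obtain ⟨I₂, h₂⟩ := (hxB.rectDefectLE_mul_d1_mul_d2 hα0 hβ0 hzB hs hs' ht ht').exists_rConv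
    (by positivity) (by linarith) (by linarith) hss' htt'
  refine ⟨I₁, I₂, h₁, h₂, eq_of_forall_dist_le fun ε hε => ?_⟩
  obtain ⟨η₁, p₁, H₁⟩ := h₁ (ε / 3) (by positivity)
  obtain ⟨η₂, p₂, H₂⟩ := h₂ (ε / 3) (by positivity)
  obtain ⟨m, n, σ, τ, gσ, gτ, mσ, mτ, hrem⟩ := hx.exists_riemannSum_chainRem_le hα hβ hφ4
    hs hss' hs' ht htt' ht' (ε := ε / 3) (by positivity) (lt_min p₁ p₂)
  have e1 := H₁ m n σ τ gσ gτ (fun i hi => (mσ i hi).trans (min_le_left _ _))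
    (fun i hi => (mτ i hi).trans (min_le_left _ _))
  have e2 := H₂ m n σ τ gσ gτ (fun i hi => (mσ i hi).trans (min_le_right _ _))
    (fun i hi => (mτ i hi).trans (min_le_right _ _))
  have hsum := riemannSum_dd (fun u v => φ (x u v)) m n σ τ
  rw [gσ.1, gσ.2.1, gτ.1, gτ.2.1] at hsum
  simp only [riemannSum, chainRem, Finset.sum_sub_distrib] at hrem hsum
  rw [hsum] at hrem
  rw [Real.dist_eq]
  rw [abs_le] at *
  constructor <;> linarith [e1.1, e1.2, e2.1, e2.2, hrem.1, hrem.2]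
end

section
/- Let V be a Banach space, T > 0, μ > 1, and let g ∈ 𝒞₂(V) satisfy ‖δg‖_μ < ∞. Then there exist f ∈ 𝒞₁(V) and r ∈ 𝒞₂(V) with ‖r‖_μ ≤ (2^μ − 2)^{−1}‖δg‖_μ such that g = δf + r (so δr = δg); here r is unique among elements of 𝒞₂(V) with the same coboundary and finite ‖·‖_ν-norm for some ν > 1, and f is unique up to an additive constant. If moreover ‖g‖_ν < ∞ for some ν > 1, then δf = 0 and g = r, i.e. the coboundary δ is invertible on 1-increments of Hölder regularity greater than 1. -/
open Set

section Sewing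

variable {V : Type*} [NormedAddCommGroup V]

/-- The coboundary of `g` vanishes at every midpoint configuration in `[a, b]`. -/
def MidpointAdditiveOn (a b : ℝ) (g : ℝ → ℝ → V) : Prop :=
  ∀ t ∈ Icc a b, ∀ s ∈ Icc a b, g t s = g t ((t + s) / 2) + g ((t + s) / 2) s

lemma midpoint_mem_Icc {a b t s : ℝ} (ht : t ∈ Icc a b) (hs : s ∈ Icc a b) :
    (t + s) / 2 ∈ Icc a b :=
  ⟨by linarith [ht.1, hs.1], by linarith [ht.2, hs.2]⟩

lemma add_mul_sub_mem_Icc {a b t s x : ℝ} (ht : t ∈ Icc a b) (hs : s ∈ Icc a b)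
    (hx : x ∈ Icc (0 : ℝ) 1) : s + x * (t - s) ∈ Icc a b := by
  obtain ⟨h0, h1⟩ := hx
  constructor
  · nlinarith [mul_nonneg h0 (sub_nonneg.2 ht.1),
      mul_nonneg (sub_nonneg.2 h1) (sub_nonneg.2 hs.1)]
  · nlinarith [mul_nonneg h0 (sub_nonneg.2 ht.2),
      mul_nonneg (sub_nonneg.2 h1) (sub_nonneg.2 hs.2)]

lemma abs_sub_midpoint (t s : ℝ) : |t - (t + s) / 2| = |t - s| / 2 := by
  rw [show t - (t + s) / 2 = (t - s) / 2 by ring, abs_div, abs_two]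

lemma abs_midpoint_sub (t s : ℝ) : |(t + s) / 2 - s| = |t - s| / 2 := by
  rw [show (t + s) / 2 - s = (t - s) / 2 by ring, abs_div, abs_two]

lemma half_rpow_eq {x : ℝ} (hx : 0 ≤ x) (μ : ℝ) :
    (x / 2) ^ μ = ((2 : ℝ) ^ μ)⁻¹ * x ^ μ := by
  rw [Real.div_rpow hx zero_le_two, div_eq_inv_mul]

lemma two_lt_two_rpow {μ : ℝ} (hμ : 1 < μ) : (2 : ℝ) < 2 ^ μ := by
  simpa using Real.rpow_lt_rpow_of_exponent_lt one_lt_two hμ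

lemma two_mul_inv_two_rpow_lt_one {μ : ℝ} (hμ : 1 < μ) : 2 * ((2 : ℝ) ^ μ)⁻¹ < 1 := by
  have := two_lt_two_rpow hμ
  rw [← div_eq_mul_inv, div_lt_one (by linarith)]
  exact this

/-- A midpoint-additive function of Hölder regularity greater than one vanishes. -/
lemma MidpointAdditiveOn.eq_zero {a b : ℝ} {g : ℝ → ℝ → V} (hg : MidpointAdditiveOn a b g)
    {μ ν K L : ℝ} (hμ : 1 < μ) (hν : 1 < ν)
    (hbd : ∀ t ∈ Icc a b, ∀ s ∈ Icc a b, ‖g t s‖ ≤ K * |t - s| ^ μ + L * |t - s| ^ ν)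
    {t s : ℝ} (ht : t ∈ Icc a b) (hs : s ∈ Icc a b) : g t s = 0 := by
  set p := 2 * ((2 : ℝ) ^ μ)⁻¹ with hp
  set q := 2 * ((2 : ℝ) ^ ν)⁻¹ with hq
  have key : ∀ n : ℕ, ∀ t ∈ Icc a b, ∀ s ∈ Icc a b,
      ‖g t s‖ ≤ p ^ n * (K * |t - s| ^ μ) + q ^ n * (L * |t - s| ^ ν) := by
    intro n
    induction n with
    | zero => simpa using hbd
    | succ n ih =>
      intro t ht s hs
      have hm := midpoint_mem_Icc ht hs
      have h1 := ih t ht _ hm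
      have h2 := ih _ hm s hs
      rw [abs_sub_midpoint, half_rpow_eq (abs_nonneg _), half_rpow_eq (abs_nonneg _)] at h1
      rw [abs_midpoint_sub, half_rpow_eq (abs_nonneg _), half_rpow_eq (abs_nonneg _)] at h2
      rw [hg t ht s hs]
      refine (norm_add_le _ _).trans ((add_le_add h1 h2).trans_eq ?_)
      linear_combination (-(p ^ n * (K * |t - s| ^ μ))) * hp - q ^ n * (L * |t - s| ^ ν) * hq
  have hp1 := tendsto_pow_atTop_nhds_zero_of_lt_one (r := p) (by positivity)
    (two_mul_inv_two_rpow_lt_one hμ)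
  have hq1 := tendsto_pow_atTop_nhds_zero_of_lt_one (r := q) (by positivity)
    (two_mul_inv_two_rpow_lt_one hν)
  have hlim := (hp1.mul_const (K * |t - s| ^ μ)).add (hq1.mul_const (L * |t - s| ^ ν))
  have := ge_of_tendsto' hlim fun n => key n t ht s hs
  simpa using this

lemma sum_range_two_mul (c : ℕ → V) (k : ℕ) :
    ∑ i ∈ Finset.range k, c i + ∑ i ∈ Finset.range k, c (k + i) =
      ∑ i ∈ Finset.range k, (c (2 * i + 1) + c (2 * i)) := by
  rw [← Finset.sum_range_add, ← two_mul]
  induction k with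
  | zero => simp
  | succ k ih =>
    rw [Finset.sum_range_succ, ← ih, show 2 * (k + 1) = 2 * k + 1 + 1 by ring,
      Finset.sum_range_succ, Finset.sum_range_succ]
    abel

/-- A midpoint-additive function whose coboundary has regularity greater than one is additive
along equidistant partitions. -/
lemma MidpointAdditiveOn.eq_sum {a b : ℝ} {A : ℝ → ℝ → V} (hA : MidpointAdditiveOn a b A)
    {μ K : ℝ} (hμ : 1 < μ)
    (hbd : ∀ t ∈ Icc a b, ∀ u ∈ Icc a b, ∀ s ∈ Icc a b, ∀ L, |t - u| ≤ L → |u - s| ≤ L →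
      ‖A t s - A t u - A u s‖ ≤ K * L ^ μ)
    {k : ℕ} (hk : k ≠ 0) {t s : ℝ} (ht : t ∈ Icc a b) (hs : s ∈ Icc a b) :
    A t s = ∑ i ∈ Finset.range k,
      A (s + (i + 1 : ℕ) / k * (t - s)) (s + (i : ℕ) / k * (t - s)) := by
  have hk' : (k : ℝ) ≠ 0 := by exact_mod_cast hk
  have hk0 : (0 : ℝ) < k := by positivity
  have hfrac : ∀ i : ℕ, i ≤ k → (i : ℝ) / k ∈ Icc (0 : ℝ) 1 := fun i hi =>
    ⟨by positivity, by rw [div_le_one hk0]; exact_mod_cast hi⟩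
  have hdiag : ∀ s ∈ Icc a b, A s s = 0 := by
    intro s hs
    have := hbd s hs s hs s hs 0 (by simp) (by simp)
    rw [Real.zero_rpow (by linarith), mul_zero, norm_le_zero_iff] at this
    simpa using this
  rw [← sub_eq_zero]
  refine MidpointAdditiveOn.eq_zero (a := a) (b := b)
    (g := fun t s => A t s - ∑ i ∈ Finset.range k,
      A (s + (i + 1 : ℕ) / k * (t - s)) (s + (i : ℕ) / k * (t - s)))
    (K := k * K) (L := 0) ?_ hμ hμ ?_ ht hs
  · intro t ht s hs
    have hsplit : ∀ i ∈ Finset.range k,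
        A (s + (i + 1 : ℕ) / k * (t - s)) (s + (i : ℕ) / k * (t - s)) =
        A (s + (2 * i + 1 + 1 : ℕ) / k * ((t + s) / 2 - s))
            (s + (2 * i + 1 : ℕ) / k * ((t + s) / 2 - s)) +
          A (s + (2 * i + 1 : ℕ) / k * ((t + s) / 2 - s))
            (s + (2 * i : ℕ) / k * ((t + s) / 2 - s)) := by
      intro i hi
      have hi := Finset.mem_range.1 hi
      rw [hA _ (add_mul_sub_mem_Icc ht hs (hfrac (i + 1) hi)) _
        (add_mul_sub_mem_Icc ht hs (hfrac i hi.le))]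
      congr 2 <;> push_cast <;> ring
    have hshift : ∀ i ∈ Finset.range k,
        A ((t + s) / 2 + (i + 1 : ℕ) / k * (t - (t + s) / 2))
          ((t + s) / 2 + (i : ℕ) / k * (t - (t + s) / 2)) =
        A (s + (k + i + 1 : ℕ) / k * ((t + s) / 2 - s))
          (s + (k + i : ℕ) / k * ((t + s) / 2 - s)) := by
      intro i _
      congr 1 <;> push_cast <;> field_simp <;> ring
    have hsum := sum_range_two_mul (fun i : ℕ => A (s + (i + 1 : ℕ) / k * ((t + s) / 2 - s))
      (s + (i : ℕ) / k * ((t + s) / 2 - s))) k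
    simp only
    rw [Finset.sum_congr rfl hsplit, Finset.sum_congr rfl hshift, ← hsum, hA t ht s hs]
    abel
  · intro t ht s hs
    have key : ∀ j : ℕ, j ≤ k → ‖A (s + (j : ℕ) / k * (t - s)) s - ∑ i ∈ Finset.range j,
        A (s + (i + 1 : ℕ) / k * (t - s)) (s + (i : ℕ) / k * (t - s))‖
          ≤ j * K * |t - s| ^ μ := by
      intro j
      induction j with
      | zero => intro _; simp [hdiag s hs]
      | succ j ih =>
        intro hj
        have h1 := hbd _ (add_mul_sub_mem_Icc ht hs (hfrac (j + 1) hj)) _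
          (add_mul_sub_mem_Icc ht hs (hfrac j (by omega))) s hs |t - s| (by
            rw [show s + ((j + 1 : ℕ) : ℝ) / k * (t - s) - (s + (j : ℝ) / k * (t - s)) =
              ((1 : ℕ) : ℝ) / k * (t - s) by push_cast; ring, abs_mul,
              abs_of_nonneg (hfrac 1 (by omega)).1]
            exact mul_le_of_le_one_left (abs_nonneg _) (hfrac 1 (by omega)).2) (by
            rw [add_sub_cancel_left, abs_mul, abs_of_nonneg (hfrac j (by omega)).1]
            exact mul_le_of_le_one_left (abs_nonneg _) (hfrac j (by omega)).2)
        have h2 := norm_add_le_of_le h1 (ih (by omega))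
        rw [Finset.sum_range_succ]
        refine (le_of_eq ?_).trans (h2.trans_eq ?_)
        · congr 1; abel
        · push_cast; ring
    have := key k le_rfl
    rw [div_self hk', one_mul, add_sub_cancel] at this
    simpa using this

/-- A continuous midpoint-additive function whose coboundary has regularity greater than one
is the increment of a function of one variable. -/
lemma MidpointAdditiveOn.eq_sub {a b : ℝ} {A : ℝ → ℝ → V} (hA : MidpointAdditiveOn a b A)
    (hc : ContinuousOn (fun p : ℝ × ℝ => A p.1 p.2) (Icc a b ×ˢ Icc a b))
    {μ K : ℝ} (hμ : 1 < μ)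
    (hbd : ∀ t ∈ Icc a b, ∀ u ∈ Icc a b, ∀ s ∈ Icc a b, ∀ L, |t - u| ≤ L → |u - s| ≤ L →
      ‖A t s - A t u - A u s‖ ≤ K * L ^ μ)
    {t s : ℝ} (ht : t ∈ Icc a b) (hs : s ∈ Icc a b) : A t s = A t a - A s a := by
  have hdiag : ∀ s ∈ Icc a b, A s s = 0 := by
    intro s hs
    have := hbd s hs s hs s hs 0 (by simp) (by simp)
    rw [Real.zero_rpow (by linarith), mul_zero, norm_le_zero_iff] at this
    simpa using this
  have ha : a ∈ Icc a b := ⟨le_rfl, ht.1.trans ht.2⟩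
  have hanti : ∀ t ∈ Icc a b, ∀ s ∈ Icc a b, A s t = - A t s := by
    intro t ht s hs
    rw [eq_neg_iff_add_eq_zero]
    refine MidpointAdditiveOn.eq_zero (a := a) (b := b) (g := fun t s => A s t + A t s)
      (K := K) (L := 0) ?_ hμ hμ ?_ ht hs
    · intro t ht s hs
      simp only
      rw [hA t ht s hs, hA s hs t ht, add_comm s t]
      abel
    · intro t ht s hs
      have := hbd t ht s hs t ht |t - s| le_rfl (abs_sub_comm s t).le
      rw [hdiag t ht, ← norm_neg] at this
      simpa [add_comm] using this
  have hrat : ∀ t ∈ Icc a b, ∀ s ∈ Icc a b, ∀ p q : ℕ, p + q ≠ 0 →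
      A t s = A t (s + (p : ℝ) / (p + q : ℕ) * (t - s))
        + A (s + (p : ℝ) / (p + q : ℕ) * (t - s)) s := by
    intro t ht s hs p q hpq
    have hk' : ((p + q : ℕ) : ℝ) ≠ 0 := by exact_mod_cast hpq
    have hk0 : (0 : ℝ) < (p + q : ℕ) := by positivity
    have hu : s + (p : ℝ) / (p + q : ℕ) * (t - s) ∈ Icc a b :=
      add_mul_sub_mem_Icc ht hs
        ⟨by positivity, by rw [div_le_one hk0]; exact_mod_cast Nat.le_add_right p q⟩
    rcases eq_or_ne p 0 with rfl | hp
    · simp [hdiag s hs]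
    rcases eq_or_ne q 0 with rfl | hq
    · have : (p : ℝ) ≠ 0 := by exact_mod_cast hp
      simp [div_self this, hdiag t ht]
    have hp' : (p : ℝ) ≠ 0 := by exact_mod_cast hp
    have hq' : (q : ℝ) ≠ 0 := by exact_mod_cast hq
    rw [hA.eq_sum hμ hbd hpq ht hs, hA.eq_sum hμ hbd hp hu hs, hA.eq_sum hμ hbd hq ht hu,
      Finset.sum_range_add, add_comm]
    push_cast at hk' ⊢
    congr 1 <;> refine Finset.sum_congr rfl fun i _ => ?_ <;> congr 1 <;> field_simp <;> ring
  have hadd : ∀ t ∈ Icc a b, ∀ s ∈ Icc a b, s ≤ t → A t a = A t s + A s a := by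
    intro t ht s hs hst
    rcases eq_or_lt_of_le ht.1 with rfl | hat
    · obtain rfl : s = a := le_antisymm hst hs.1
      simp [hdiag s hs]
    set x := (s - a) / (t - a) with hx
    have hta : 0 < t - a := sub_pos.2 hat
    have hx0 : 0 ≤ x := div_nonneg (sub_nonneg.2 hs.1) hta.le
    have hx1 : x ≤ 1 := by rw [hx, div_le_one hta]; linarith
    have hlim : Filter.Tendsto (fun n : ℕ => a + (⌊x * n⌋₊ : ℝ) / n * (t - a)) Filter.atTop
        (nhds s) := by
      have h := ((tendsto_nat_floor_mul_div_atTop hx0).comp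
        (tendsto_natCast_atTop_atTop (R := ℝ))).mul_const (t - a) |>.const_add a
      rwa [show a + x * (t - a) = s by rw [hx]; field_simp; ring] at h
    have hfl : ∀ n : ℕ, ⌊x * n⌋₊ ≤ n := fun n =>
      Nat.floor_le_of_le (mul_le_of_le_one_left (Nat.cast_nonneg n) hx1)
    have hmem : ∀ n : ℕ, a + (⌊x * n⌋₊ : ℝ) / n * (t - a) ∈ Icc a b := fun n =>
      add_mul_sub_mem_Icc ht ha
        ⟨by positivity, div_le_one_of_le₀ (by exact_mod_cast hfl n) (Nat.cast_nonneg n)⟩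
    have h1 := (hc (t, s) ⟨ht, hs⟩).tendsto.comp (tendsto_nhdsWithin_iff.2
      ⟨(tendsto_const_nhds (x := t)).prodMk_nhds hlim,
        Filter.Eventually.of_forall fun n => ⟨ht, hmem n⟩⟩)
    have h2 := (hc (s, a) ⟨hs, ha⟩).tendsto.comp (tendsto_nhdsWithin_iff.2
      ⟨hlim.prodMk_nhds (tendsto_const_nhds (x := a)),
        Filter.Eventually.of_forall fun n => ⟨hmem n, ha⟩⟩)
    refine tendsto_nhds_unique (tendsto_const_nhds.congr' ?_) (h1.add h2)
    filter_upwards [Filter.eventually_ne_atTop 0] with n hn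
    have := hrat t ht a ha ⌊x * n⌋₊ (n - ⌊x * n⌋₊) (by have := hfl n; omega)
    rw [Nat.add_sub_cancel' (hfl n)] at this
    exact this
  rcases le_total s t with h | h
  · rw [hadd t ht s hs h]; abel
  · rw [hadd s hs t ht h, hanti t ht s hs]; abel

/-- Iterated dyadic refinement of `d`, the increments being summed over the `2 ^ n` dyadic
subintervals. -/
noncomputable def dyadicSum (d : ℝ → ℝ → V) : ℕ → ℝ → ℝ → V
  | 0 => d
  | n + 1 => fun t s => dyadicSum d n t ((t + s) / 2) + dyadicSum d n ((t + s) / 2) s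

lemma norm_dyadicSum_le {a b : ℝ} {d : ℝ → ℝ → V} {μ K : ℝ}
    (hd : ∀ t ∈ Icc a b, ∀ s ∈ Icc a b, ‖d t s‖ ≤ K * |t - s| ^ μ) (n : ℕ) :
    ∀ t ∈ Icc a b, ∀ s ∈ Icc a b,
      ‖dyadicSum d n t s‖ ≤ K * |t - s| ^ μ * (2 * ((2 : ℝ) ^ μ)⁻¹) ^ n := by
  induction n with
  | zero => simpa [dyadicSum] using hd
  | succ n ih =>
    intro t ht s hs
    have hm := midpoint_mem_Icc ht hs
    have h1 := ih t ht _ hm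
    have h2 := ih _ hm s hs
    rw [abs_sub_midpoint, half_rpow_eq (abs_nonneg _)] at h1
    rw [abs_midpoint_sub, half_rpow_eq (abs_nonneg _)] at h2
    exact (norm_add_le_of_le h1 h2).trans_eq (by ring)

lemma continuousOn_dyadicSum {a b : ℝ} {d : ℝ → ℝ → V}
    (hd : ContinuousOn (fun p : ℝ × ℝ => d p.1 p.2) (Icc a b ×ˢ Icc a b)) (n : ℕ) :
    ContinuousOn (fun p : ℝ × ℝ => dyadicSum d n p.1 p.2) (Icc a b ×ˢ Icc a b) := by
  induction n with
  | zero => exact hd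
  | succ n ih =>
    refine ContinuousOn.add
      (ih.comp (f := fun p : ℝ × ℝ => (p.1, (p.1 + p.2) / 2)) (by fun_prop) fun p hp => ?_)
      (ih.comp (f := fun p : ℝ × ℝ => ((p.1 + p.2) / 2, p.2)) (by fun_prop) fun p hp => ?_)
    · exact ⟨hp.1, midpoint_mem_Icc hp.1 hp.2⟩
    · exact ⟨midpoint_mem_Icc hp.1 hp.2, hp.2⟩

lemma summable_dyadicSum [CompleteSpace V] {a b : ℝ} {d : ℝ → ℝ → V} {μ K : ℝ} (hμ : 1 < μ)
    (hd : ∀ t ∈ Icc a b, ∀ s ∈ Icc a b, ‖d t s‖ ≤ K * |t - s| ^ μ)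
    {t s : ℝ} (ht : t ∈ Icc a b) (hs : s ∈ Icc a b) :
    Summable fun n => dyadicSum d n t s :=
  Summable.of_norm_bounded ((summable_geometric_of_lt_one (by positivity)
    (two_mul_inv_two_rpow_lt_one hμ)).mul_left _) fun n => norm_dyadicSum_le hd n t ht s hs

lemma norm_tsum_dyadicSum_le {a b : ℝ} {d : ℝ → ℝ → V} {μ K : ℝ} (hμ : 1 < μ)
    (hd : ∀ t ∈ Icc a b, ∀ s ∈ Icc a b, ‖d t s‖ ≤ K * ((2 : ℝ) ^ μ)⁻¹ * |t - s| ^ μ)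
    {t s : ℝ} (ht : t ∈ Icc a b) (hs : s ∈ Icc a b) :
    ‖∑' n, dyadicSum d n t s‖ ≤ ((2 : ℝ) ^ μ - 2)⁻¹ * K * |t - s| ^ μ := by
  have h := tsum_of_norm_bounded ((hasSum_geometric_of_lt_one (by positivity)
    (two_mul_inv_two_rpow_lt_one hμ)).mul_left _) fun n => norm_dyadicSum_le hd n t ht s hs
  refine h.trans_eq ?_
  have h2 := two_lt_two_rpow hμ
  have h3 : (2 : ℝ) ^ μ ≠ 0 := by positivity
  have h4 : (2 : ℝ) ^ μ - 2 ≠ 0 := by linarith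
  have h5 : 1 - 2 * ((2 : ℝ) ^ μ)⁻¹ = ((2 : ℝ) ^ μ)⁻¹ * (2 ^ μ - 2) := by field_simp
  rw [h5]
  field_simp

lemma continuousOn_tsum_dyadicSum [CompleteSpace V] {a b : ℝ} {d : ℝ → ℝ → V} {μ K : ℝ} (hμ : 1 < μ)
    (hK : 0 ≤ K) (hdc : ContinuousOn (fun p : ℝ × ℝ => d p.1 p.2) (Icc a b ×ˢ Icc a b))
    (hd : ∀ t ∈ Icc a b, ∀ s ∈ Icc a b, ‖d t s‖ ≤ K * |t - s| ^ μ) :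
    ContinuousOn (fun p : ℝ × ℝ => ∑' n, dyadicSum d n p.1 p.2) (Icc a b ×ˢ Icc a b) := by
  refine continuousOn_tsum (u := fun n => K * |b - a| ^ μ * (2 * ((2 : ℝ) ^ μ)⁻¹) ^ n)
    (continuousOn_dyadicSum hdc) ((summable_geometric_of_lt_one (by positivity)
      (two_mul_inv_two_rpow_lt_one hμ)).mul_left _) fun n p hp => ?_
  refine (norm_dyadicSum_le hd n p.1 hp.1 p.2 hp.2).trans ?_
  have : |p.1 - p.2| ≤ |b - a| := by
    rw [abs_le]
    have := le_abs_self (b - a)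
    constructor <;> linarith [hp.1.1, hp.1.2, hp.2.1, hp.2.2]
  gcongr

/-- The defining property of the dyadic series: its coboundary at a midpoint is `d`. -/
lemma tsum_dyadicSum_eq [CompleteSpace V] {a b : ℝ} {d : ℝ → ℝ → V} {μ K : ℝ} (hμ : 1 < μ)
    (hd : ∀ t ∈ Icc a b, ∀ s ∈ Icc a b, ‖d t s‖ ≤ K * |t - s| ^ μ)
    {t s : ℝ} (ht : t ∈ Icc a b) (hs : s ∈ Icc a b) :
    ∑' n, dyadicSum d n t s = d t s + (∑' n, dyadicSum d n t ((t + s) / 2) +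
      ∑' n, dyadicSum d n ((t + s) / 2) s) := by
  have hm := midpoint_mem_Icc ht hs
  rw [(summable_dyadicSum hμ hd ht hs).tsum_eq_zero_add,
    ← (summable_dyadicSum hμ hd ht hm).tsum_add (summable_dyadicSum hμ hd hm hs)]
  rfl

/-- A finite sum of products of Hölder bounds of total exponent `μ` is a bound by the `μ`-th
power of any number dominating both distances. -/
lemma norm_sum_le_of_holder {ι : Type*} [Fintype ι] {h : ι → V} {C ρ : ι → ℝ} {μ x y L : ℝ}
    (hx : 0 ≤ x) (hy : 0 ≤ y) (hC : ∀ k, 0 ≤ C k) (hρ : ∀ k, ρ k ∈ Ioo (0 : ℝ) μ)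
    (hh : ∀ k, ‖h k‖ ≤ C k * x ^ ρ k * y ^ (μ - ρ k)) (hxL : x ≤ L) (hyL : y ≤ L) :
    ‖∑ k, h k‖ ≤ (∑ k, C k) * L ^ μ := by
  rw [Finset.sum_mul]
  refine norm_sum_le_of_le _ fun k _ => (hh k).trans ?_
  have h1 := (hρ k).1.le
  have h2 : 0 ≤ μ - ρ k := sub_nonneg.2 (hρ k).2.le
  have hCk := hC k
  rw [mul_assoc]
  gcongr
  have hL : 0 ≤ L := hx.trans hxL
  calc x ^ ρ k * y ^ (μ - ρ k) ≤ L ^ ρ k * L ^ (μ - ρ k) := by gcongr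
    _ = L ^ μ := by
      rw [← Real.rpow_add_of_nonneg hL h1 h2, add_sub_cancel]

end Sewing

/-- **Decomposition of 1-increments with regular coboundary.**
Let `V` be a Banach space, `T > 0`, `μ > 1`, and let `g ∈ 𝒞₂(V)` satisfy `‖δg‖_μ < ∞`
(witnessed by a finite decomposition of `δg`).  Then `g = δf + r` with `f ∈ 𝒞₁(V)`,
`r ∈ 𝒞₂(V)`, `‖r‖_μ ≤ (2^μ-2)⁻¹ ‖δg‖_μ`; `r` is unique among 1-increments with the same
coboundary and some finite `ν`-norm (`ν > 1`), and `f` is unique up to an additive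
constant.  If moreover `‖g‖_ν < ∞` for some `ν > 1`, then `δf = 0` and `g = r`. -/
theorem stmt6
    {V : Type*} [NormedAddCommGroup V] [NormedSpace ℝ V] [CompleteSpace V]
    (T : ℝ) (hT : 0 < T) (μ : ℝ) (hμ : 1 < μ)
    (g : ℝ → ℝ → V)
    (hgc : ContinuousOn (fun p : ℝ × ℝ => g p.1 p.2) (Icc 0 T ×ˢ Icc 0 T))
    (hg0 : ∀ t ∈ Icc 0 T, g t t = 0)
    -- `‖δg‖_μ < ∞`: existence of a finite decomposition of δg
    (hfin : ∃ (N : ℕ) (hdec : Fin N → ℝ → ℝ → ℝ → V) (C ρ : Fin N → ℝ),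
      (∀ k, 0 ≤ C k) ∧ (∀ k, ρ k ∈ Set.Ioo (0:ℝ) μ) ∧
      (∀ t u s, t ∈ Icc 0 T → u ∈ Icc 0 T → s ∈ Icc 0 T →
        g t s - g t u - g u s = ∑ k, hdec k t u s) ∧
      (∀ k, ∀ t u s, t ∈ Icc 0 T → u ∈ Icc 0 T → s ∈ Icc 0 T →
        ‖hdec k t u s‖ ≤ C k * |t - u| ^ (ρ k) * |u - s| ^ (μ - ρ k))) :
    ∃ (f : ℝ → V) (r : ℝ → ℝ → V),
      -- f ∈ 𝒞₁(V), r ∈ 𝒞₂(V)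
      ContinuousOn f (Icc 0 T) ∧
      (ContinuousOn (fun p : ℝ × ℝ => r p.1 p.2) (Icc 0 T ×ˢ Icc 0 T) ∧
        ∀ t ∈ Icc 0 T, r t t = 0) ∧
      -- g = δf + r
      (∀ t s, t ∈ Icc 0 T → s ∈ Icc 0 T → g t s = (f t - f s) + r t s) ∧
      -- ‖r‖_μ ≤ (2^μ-2)⁻¹ ‖δg‖_μ : bound for every decomposition of δg
      (∀ (N : ℕ) (hdec : Fin N → ℝ → ℝ → ℝ → V) (C ρ : Fin N → ℝ),
        (∀ k, 0 ≤ C k) → (∀ k, ρ k ∈ Set.Ioo (0:ℝ) μ) →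
        (∀ t u s, t ∈ Icc 0 T → u ∈ Icc 0 T → s ∈ Icc 0 T →
          g t s - g t u - g u s = ∑ k, hdec k t u s) →
        (∀ k, ∀ t u s, t ∈ Icc 0 T → u ∈ Icc 0 T → s ∈ Icc 0 T →
          ‖hdec k t u s‖ ≤ C k * |t - u| ^ (ρ k) * |u - s| ^ (μ - ρ k)) →
        ∀ t s, t ∈ Icc 0 T → s ∈ Icc 0 T →
          ‖r t s‖ ≤ ((2:ℝ) ^ μ - 2)⁻¹ * (∑ k, C k) * |t - s| ^ μ) ∧
      -- uniqueness of r among 1-increments with the same coboundary and finite ν-norm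
      (∀ r' : ℝ → ℝ → V,
        (ContinuousOn (fun p : ℝ × ℝ => r' p.1 p.2) (Icc 0 T ×ˢ Icc 0 T) ∧
          ∀ t ∈ Icc 0 T, r' t t = 0) →
        (∀ t u s, t ∈ Icc 0 T → u ∈ Icc 0 T → s ∈ Icc 0 T →
          r' t s - r' t u - r' u s = g t s - g t u - g u s) →
        (∃ ν > (1:ℝ), ∃ K : ℝ, ∀ t s, t ∈ Icc 0 T → s ∈ Icc 0 T →
          ‖r' t s‖ ≤ K * |t - s| ^ ν) →
        ∀ t s, t ∈ Icc 0 T → s ∈ Icc 0 T → r' t s = r t s) ∧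
      -- uniqueness of f up to an additive constant
      (∀ f' : ℝ → V, ContinuousOn f' (Icc 0 T) →
        (∀ t s, t ∈ Icc 0 T → s ∈ Icc 0 T → g t s = (f' t - f' s) + r t s) →
        ∃ v : V, ∀ t ∈ Icc 0 T, f' t = f t + v) ∧
      -- if moreover ‖g‖_ν < ∞ for some ν > 1, then δf = 0 and g = r
      ((∃ ν > (1:ℝ), ∃ K : ℝ, ∀ t s, t ∈ Icc 0 T → s ∈ Icc 0 T →
          ‖g t s‖ ≤ K * |t - s| ^ ν) →
        ∀ t s, t ∈ Icc 0 T → s ∈ Icc 0 T → f t - f s = 0 ∧ g t s = r t s) := by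
  obtain ⟨N₀, h₀, C₀, ρ₀, hC₀, hρ₀, hdec₀, hbd₀⟩ := hfin
  set d : ℝ → ℝ → V := fun t s => g t s - g t ((t + s) / 2) - g ((t + s) / 2) s with hd
  set r : ℝ → ℝ → V := fun t s => ∑' n, dyadicSum d n t s with hr
  have hcob : ∀ (N : ℕ) (hdec : Fin N → ℝ → ℝ → ℝ → V) (C ρ : Fin N → ℝ),
      (∀ k, 0 ≤ C k) → (∀ k, ρ k ∈ Set.Ioo (0:ℝ) μ) →
      (∀ t u s, t ∈ Icc 0 T → u ∈ Icc 0 T → s ∈ Icc 0 T →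
        g t s - g t u - g u s = ∑ k, hdec k t u s) →
      (∀ k, ∀ t u s, t ∈ Icc 0 T → u ∈ Icc 0 T → s ∈ Icc 0 T →
        ‖hdec k t u s‖ ≤ C k * |t - u| ^ (ρ k) * |u - s| ^ (μ - ρ k)) →
      ∀ t ∈ Icc 0 T, ∀ u ∈ Icc 0 T, ∀ s ∈ Icc 0 T, ∀ L, |t - u| ≤ L → |u - s| ≤ L →
        ‖g t s - g t u - g u s‖ ≤ (∑ k, C k) * L ^ μ := by
    intro N hdec C ρ hC hρ hsum hbd t ht u hu s hs L h1 h2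
    rw [hsum t u s ht hu hs]
    exact norm_sum_le_of_holder (abs_nonneg _) (abs_nonneg _) hC hρ
      (fun k => hbd k t u s ht hu hs) h1 h2
  have hmid : ∀ M : ℝ, (∀ t ∈ Icc 0 T, ∀ u ∈ Icc 0 T, ∀ s ∈ Icc 0 T, ∀ L, |t - u| ≤ L →
      |u - s| ≤ L → ‖g t s - g t u - g u s‖ ≤ M * L ^ μ) →
      ∀ t ∈ Icc 0 T, ∀ s ∈ Icc 0 T, ‖d t s‖ ≤ M * ((2 : ℝ) ^ μ)⁻¹ * |t - s| ^ μ := by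
    intro M hM t ht s hs
    have := hM t ht _ (midpoint_mem_Icc ht hs) s hs (|t - s| / 2)
      (abs_sub_midpoint t s).le (abs_midpoint_sub t s).le
    rwa [half_rpow_eq (abs_nonneg _), ← mul_assoc] at this
  set M := ∑ k, C₀ k with hM
  have hM0 : 0 ≤ M := Finset.sum_nonneg fun k _ => hC₀ k
  have hcob₀ := hcob N₀ h₀ C₀ ρ₀ hC₀ hρ₀ hdec₀ hbd₀
  have hd₀ := hmid M hcob₀
  have hdc : ContinuousOn (fun p : ℝ × ℝ => d p.1 p.2) (Icc 0 T ×ˢ Icc 0 T) := by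
    refine (hgc.sub
      (hgc.comp (f := fun p : ℝ × ℝ => (p.1, (p.1 + p.2) / 2)) (by fun_prop) fun p hp => ?_)).sub
      (hgc.comp (f := fun p : ℝ × ℝ => ((p.1 + p.2) / 2, p.2)) (by fun_prop) fun p hp => ?_)
    · exact ⟨hp.1, midpoint_mem_Icc hp.1 hp.2⟩
    · exact ⟨midpoint_mem_Icc hp.1 hp.2, hp.2⟩
  have hrc : ContinuousOn (fun p : ℝ × ℝ => r p.1 p.2) (Icc 0 T ×ˢ Icc 0 T) :=
    continuousOn_tsum_dyadicSum hμ (by positivity) hdc hd₀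
  set R := ((2 : ℝ) ^ μ - 2)⁻¹ * M with hR
  have hR0 : 0 ≤ R :=
    mul_nonneg (inv_nonneg.2 (sub_nonneg.2 (two_lt_two_rpow hμ).le)) hM0
  have hrbd : ∀ t ∈ Icc 0 T, ∀ s ∈ Icc 0 T, ‖r t s‖ ≤ R * |t - s| ^ μ :=
    fun t ht s hs => norm_tsum_dyadicSum_le hμ hd₀ ht hs
  have hrd : ∀ t ∈ Icc 0 T, r t t = 0 := by
    intro t ht
    simpa [Real.zero_rpow (by linarith : μ ≠ 0)] using hrbd t ht t ht
  have hA : MidpointAdditiveOn 0 T fun t s => g t s - r t s := by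
    intro t ht s hs
    simp only [hr]
    rw [tsum_dyadicSum_eq hμ hd₀ ht hs]
    simp only [hd]
    abel
  have hAc : ContinuousOn (fun p : ℝ × ℝ => g p.1 p.2 - r p.1 p.2) (Icc 0 T ×ˢ Icc 0 T) :=
    hgc.sub hrc
  have hAbd : ∀ t ∈ Icc 0 T, ∀ u ∈ Icc 0 T, ∀ s ∈ Icc 0 T, ∀ L, |t - u| ≤ L → |u - s| ≤ L →
      ‖(g t s - r t s) - (g t u - r t u) - (g u s - r u s)‖
        ≤ (M + R * 2 ^ μ + R + R) * L ^ μ := by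
    intro t ht u hu s hs L h1 h2
    have hL : 0 ≤ L := (abs_nonneg _).trans h1
    have hts : |t - s| ≤ 2 * L := (abs_sub_le t u s).trans (by linarith)
    have e0 := hcob₀ t ht u hu s hs L h1 h2
    have e1 : ‖r t s‖ ≤ R * (2 * L) ^ μ := (hrbd t ht s hs).trans (by gcongr)
    have e2 : ‖r t u‖ ≤ R * L ^ μ := (hrbd t ht u hu).trans (by gcongr)
    have e3 : ‖r u s‖ ≤ R * L ^ μ := (hrbd u hu s hs).trans (by gcongr)
    rw [Real.mul_rpow zero_le_two hL] at e1
    have := norm_add_le_of_le (norm_add_le_of_le (norm_sub_le_of_le e0 e1) e2) e3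
    refine (le_of_eq ?_).trans (this.trans_eq (by ring))
    congr 1
    abel
  have hdecomp : ∀ t ∈ Icc 0 T, ∀ s ∈ Icc 0 T, g t s - r t s = (g t 0 - r t 0) - (g s 0 - r s 0) :=
    fun t ht s hs => hA.eq_sub hAc hμ hAbd ht hs
  have h0 : (0 : ℝ) ∈ Icc 0 T := ⟨le_rfl, hT.le⟩
  have huniq : ∀ r' : ℝ → ℝ → V,
      (∀ t u s, t ∈ Icc 0 T → u ∈ Icc 0 T → s ∈ Icc 0 T →
        r' t s - r' t u - r' u s = g t s - g t u - g u s) →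
      (∃ ν > (1:ℝ), ∃ K : ℝ, ∀ t s, t ∈ Icc 0 T → s ∈ Icc 0 T →
        ‖r' t s‖ ≤ K * |t - s| ^ ν) →
      ∀ t s, t ∈ Icc 0 T → s ∈ Icc 0 T → r' t s = r t s := by
    rintro r' hr' ⟨ν, hν, K, hK⟩ t s ht hs
    rw [← sub_eq_zero]
    refine MidpointAdditiveOn.eq_zero (a := 0) (b := T) (g := fun t s => r' t s - r t s)
      ?_ hν hμ (fun t ht s hs => norm_sub_le_of_le (hK t s ht hs) (hrbd t ht s hs)) ht hs
    intro t ht s hs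
    have e1 := hA t ht s hs
    have e2 := hr' t _ s ht (midpoint_mem_Icc ht hs) hs
    simp only at e1 ⊢
    rw [← sub_eq_zero] at e1 e2 ⊢
    rw [← add_zero (0 : V)]
    nth_rewrite 1 [← e1]
    rw [← e2]
    abel
  refine ⟨fun t => g t 0 - r t 0, r, ?_, ⟨hrc, hrd⟩, ?_, ?_, fun r' _ => huniq r', ?_, ?_⟩
  · exact hAc.comp (f := fun t : ℝ => (t, (0 : ℝ))) (by fun_prop) fun t ht => ⟨ht, h0⟩
  · intro t s ht hs
    rw [← hdecomp t ht s hs, sub_add_cancel]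
  · intro N hdec C ρ hC hρ hsum hbd t s ht hs
    exact norm_tsum_dyadicSum_le hμ (hmid _ (hcob N hdec C ρ hC hρ hsum hbd)) ht hs
  · intro f' _ hf'
    refine ⟨f' 0, fun t ht => ?_⟩
    simp only
    rw [hf' t 0 ht h0]
    abel
  · intro hg t s ht hs
    have e := huniq g (fun _ _ _ _ _ _ => rfl) hg
    refine ⟨?_, e t s ht hs⟩
    simp only
    rw [e t 0 ht h0, e s 0 hs h0]
    abel
end

section
/- Let p > 1 and α, β ∈ (1/3, 1/2]. There exists a constant C = C(α,β,p) such that for every continuous function y : [0,1]² → ℝ and all s₁,s₂,t₁,t₂ ∈ [0,1], |(δy)(s₁,s₂;t₁,t₂)|^p ≤ C |s₂−s₁|^{αp} |t₂−t₁|^{βp} ∫_{[0,1]⁴} |(δy)(u₁,u₂;v₁,v₂)|^p / (|u₂−u₁|^{αp+2} |v₂−v₁|^{βp+2}) du₁ du₂ dv₁ dv₂; equivalently, ‖δy‖_{α,β} ≤ C^{1/p} U where U = ( ∫_{[0,1]⁴} |(δy)(u₁,u₂;v₁,v₂)|^p / (|u₂−u₁|^{αp+2}|v₂−v₁|^{βp+2})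 du₁ du₂ dv₁ dv₂ )^{1/p} (a two-parameter Garsia–Rodemich–Rumsey inequality). -/
open Set MeasureTheory

open Filter Topology

/-- The integrand of the Garsia–Rodemich–Rumsey functional. -/
noncomputable def grrKernel (p γ : ℝ) (g : ℝ → ℝ) (u v : ℝ) : ENNReal :=
  ENNReal.ofReal (|g v - g u| ^ p / |v - u| ^ (γ * p + 2))

/-- The mean of `g` over the segment from `s` to `s + a`. -/
noncomputable def segmentMean (g : ℝ → ℝ) (s a : ℝ) : ℝ :=
  ∫ x in Icc (0 : ℝ) 1, g (s + a * x)

lemma ofReal_abs_setIntegral_rpow_le {p : ℝ} (hp : 1 < p) {f : ℝ → ℝ} (hf : Continuous f) :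
    ENNReal.ofReal (|∫ x in Icc (0 : ℝ) 1, f x| ^ p) ≤
      ∫⁻ x in Icc (0 : ℝ) 1, ENNReal.ofReal (|f x| ^ p) := by
  have hp0 : 0 < p := by linarith
  have key : |∫ x in Icc (0 : ℝ) 1, f x| ^ p ≤ ∫ x in Icc (0 : ℝ) 1, |f x| ^ p := by
    have hconv : ConvexOn ℝ univ (fun x : ℝ => |x| ^ p) := by
      refine ⟨convex_univ, fun x _ y _ a b ha hb hab => ?_⟩
      have h1 : |a • x + b • y| ≤ a • |x| + b • |y| := by
        simpa [abs_mul, abs_of_nonneg ha, abs_of_nonneg hb] using abs_add_le (a * x) (b * y)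
      exact (Real.rpow_le_rpow (abs_nonneg _) h1 hp0.le).trans
        ((convexOn_rpow hp.le).2 (abs_nonneg x) (abs_nonneg y) ha hb hab)
    have : IsProbabilityMeasure (volume.restrict (Icc (0 : ℝ) 1)) := ⟨by simp⟩
    exact hconv.map_integral_le
      (continuous_abs.rpow_const fun _ => Or.inr hp0.le).continuousOn isClosed_univ
      (by simp) (hf.integrableOn_Icc)
      ((hf.abs.rpow_const fun _ => Or.inr hp0.le).integrableOn_Icc)
  refine (ENNReal.ofReal_le_ofReal key).trans_eq ?_
  exact ofReal_integral_eq_lintegral_ofReal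
    ((hf.abs.rpow_const fun _ => Or.inr hp0.le).integrableOn_Icc)
    (Eventually.of_forall fun x => by positivity)

lemma add_mul_mem_Icc {s a x : ℝ} (hs : s ∈ Icc (0 : ℝ) 1) (ha : s + a ∈ Icc (0 : ℝ) 1)
    (hx : x ∈ Icc (0 : ℝ) 1) : s + a * x ∈ Icc (0 : ℝ) 1 := by
  obtain ⟨h1, h2⟩ := hs
  obtain ⟨h3, h4⟩ := ha
  obtain ⟨h5, h6⟩ := hx
  constructor <;> nlinarith

lemma setLIntegral_comp_add_mul_le {s a : ℝ} (ha : a ≠ 0) (hs : s ∈ Icc (0 : ℝ) 1)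
    (hsa : s + a ∈ Icc (0 : ℝ) 1) (F : ℝ → ENNReal) :
    ∫⁻ x in Icc (0 : ℝ) 1, F (s + a * x) ≤
      ENNReal.ofReal |a|⁻¹ * ∫⁻ u in Icc (0 : ℝ) 1, F u := by
  have himg : (fun x => s + a * x) '' Icc (0 : ℝ) 1 ⊆ Icc 0 1 := by
    rintro _ ⟨x, hx, rfl⟩
    exact add_mul_mem_Icc hs hsa hx
  have hcv := lintegral_image_eq_lintegral_abs_deriv_mul (s := Icc (0 : ℝ) 1)
    (f := fun x => s + a * x) (f' := fun _ => a) measurableSet_Icc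
    (fun x _ => by
      simpa using (((hasDerivAt_id x).const_mul a).const_add s).hasDerivWithinAt)
    (fun x _ y _ h => by simpa [ha] using h) F
  rw [lintegral_const_mul' _ _ ENNReal.ofReal_ne_top] at hcv
  have hle := lintegral_mono_set (μ := volume) (f := F) himg
  rw [hcv] at hle
  calc ∫⁻ x in Icc (0 : ℝ) 1, F (s + a * x)
      = ENNReal.ofReal |a|⁻¹ *
          (ENNReal.ofReal |a| * ∫⁻ x in Icc (0 : ℝ) 1, F (s + a * x)) := by
        rw [← mul_assoc, ← ENNReal.ofReal_mul (by positivity),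
          inv_mul_cancel₀ (abs_ne_zero.mpr ha), ENNReal.ofReal_one, one_mul]
    _ ≤ _ := by gcongr

lemma ofReal_abs_segmentMean_sub_half_rpow_le {p γ : ℝ} (hp : 1 < p) (hγ : 0 < γ) {g : ℝ → ℝ}
    (hg : Continuous g) {s a : ℝ} (ha : a ≠ 0) (hs : s ∈ Icc (0 : ℝ) 1)
    (hsa : s + a ∈ Icc (0 : ℝ) 1) :
    ENNReal.ofReal (|segmentMean g s (a / 2) - segmentMean g s a| ^ p) ≤
      ENNReal.ofReal (2 * |a| ^ (γ * p)) *
        ∫⁻ u in Icc (0 : ℝ) 1, ∫⁻ v in Icc (0 : ℝ) 1, grrKernel p γ g u v := by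
  have hp0 : 0 < p := by linarith
  have ha' : 0 < |a| := abs_pos.mpr ha
  have hsa2 : s + a / 2 ∈ Icc (0 : ℝ) 1 := by
    constructor <;> linarith [hs.1, hs.2, hsa.1, hsa.2]
  have hint : ∀ b, IntegrableOn (fun x => g (s + b * x)) (Icc (0 : ℝ) 1) := fun b =>
    (by fun_prop : Continuous fun x => g (s + b * x)).integrableOn_Icc
  have hmean : ∀ b c, segmentMean g s b - c = ∫ x in Icc (0 : ℝ) 1, (g (s + b * x) - c) := by
    intro b c
    rw [integral_sub (hint b) (by simp)]
    simp [segmentMean]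
  have hmean' : ∀ b c, c - segmentMean g s b = ∫ x in Icc (0 : ℝ) 1, (c - g (s + b * x)) := by
    intro b c
    rw [integral_sub (by simp) (hint b)]
    simp [segmentMean]
  have hpt : ∀ x ∈ Icc (0 : ℝ) 1, ∀ x' ∈ Icc (0 : ℝ) 1,
      ENNReal.ofReal (|g (s + a / 2 * x') - g (s + a * x)| ^ p) ≤
        ENNReal.ofReal (|a| ^ (γ * p + 2)) *
          grrKernel p γ g (s + a * x) (s + a / 2 * x') := by
    intro x hx x' hx'
    rw [grrKernel, ← ENNReal.ofReal_mul (by positivity)]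
    apply ENNReal.ofReal_le_ofReal
    set u := s + a * x with hu
    set v := s + a / 2 * x' with hv
    rcases eq_or_ne v u with h | h
    · simp [h, Real.zero_rpow hp0.ne']
    have hd : 0 < |v - u| := abs_pos.mpr (sub_ne_zero.mpr h)
    have hle : |v - u| ≤ |a| := by
      have : v - u = a * (x' / 2 - x) := by rw [hu, hv]; ring
      rw [this, abs_mul]
      have : |x' / 2 - x| ≤ 1 := by
        rw [abs_le]; constructor <;> linarith [hx.1, hx.2, hx'.1, hx'.2]
      nlinarith
    have hpow : |v - u| ^ (γ * p + 2) ≤ |a| ^ (γ * p + 2) :=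
      Real.rpow_le_rpow hd.le hle (by positivity)
    rw [← mul_div_assoc, le_div_iff₀ (by positivity), mul_comm]
    gcongr
  calc ENNReal.ofReal (|segmentMean g s (a / 2) - segmentMean g s a| ^ p)
      ≤ ∫⁻ x in Icc (0 : ℝ) 1,
          ENNReal.ofReal (|segmentMean g s (a / 2) - g (s + a * x)| ^ p) := by
        rw [hmean']
        exact ofReal_abs_setIntegral_rpow_le hp (by fun_prop)
    _ ≤ ∫⁻ x in Icc (0 : ℝ) 1, ∫⁻ x' in Icc (0 : ℝ) 1,
          ENNReal.ofReal (|g (s + a / 2 * x') - g (s + a * x)| ^ p) := by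
        refine lintegral_mono fun x => ?_
        simp only [hmean]
        exact ofReal_abs_setIntegral_rpow_le hp (by fun_prop)
    _ ≤ ∫⁻ x in Icc (0 : ℝ) 1, ∫⁻ x' in Icc (0 : ℝ) 1,
          ENNReal.ofReal (|a| ^ (γ * p + 2)) *
            grrKernel p γ g (s + a * x) (s + a / 2 * x') :=
        setLIntegral_mono' measurableSet_Icc fun x hx =>
          setLIntegral_mono' measurableSet_Icc fun x' hx' => hpt x hx x' hx'
    _ ≤ ∫⁻ x in Icc (0 : ℝ) 1, ENNReal.ofReal (|a| ^ (γ * p + 2)) *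
          (ENNReal.ofReal |a / 2|⁻¹ * ∫⁻ v in Icc (0 : ℝ) 1, grrKernel p γ g (s + a * x) v) := by
        refine lintegral_mono fun x => ?_
        simp only []
        rw [lintegral_const_mul' _ _ ENNReal.ofReal_ne_top]
        gcongr
        exact setLIntegral_comp_add_mul_le (div_ne_zero ha two_ne_zero) hs hsa2
          (grrKernel p γ g (s + a * x))
    _ ≤ ENNReal.ofReal (|a| ^ (γ * p + 2)) * (ENNReal.ofReal |a / 2|⁻¹ *
          (ENNReal.ofReal |a|⁻¹ *
            ∫⁻ u in Icc (0 : ℝ) 1, ∫⁻ v in Icc (0 : ℝ) 1, grrKernel p γ g u v)) := by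
        rw [lintegral_const_mul' _ _ ENNReal.ofReal_ne_top,
          lintegral_const_mul' _ _ ENNReal.ofReal_ne_top]
        gcongr
        exact setLIntegral_comp_add_mul_le ha hs hsa
          fun u => ∫⁻ v in Icc (0 : ℝ) 1, grrKernel p γ g u v
    _ = _ := by
        rw [← mul_assoc, ← mul_assoc, ← ENNReal.ofReal_mul (by positivity),
          ← ENNReal.ofReal_mul (by positivity)]
        congr 2
        rw [Real.rpow_add ha', abs_div, Real.rpow_two]
        field_simp
        norm_num

lemma tendsto_segmentMean_zero {g : ℝ → ℝ} (hg : Continuous g) (s : ℝ) {a : ℕ → ℝ}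
    (ha : Tendsto a atTop (𝓝 0)) : Tendsto (fun n => segmentMean g s (a n)) atTop (𝓝 (g s)) := by
  have hcont : Continuous (segmentMean g s) := by
    unfold segmentMean
    exact continuous_parametric_integral_of_continuous (f := fun a x => g (s + a * x))
      (by fun_prop) isCompact_Icc
  have h0 : segmentMean g s 0 = g s := by simp [segmentMean]
  rw [← h0]
  exact (hcont.tendsto 0).comp ha

lemma segmentMean_reverse (g : ℝ → ℝ) (s t : ℝ) :
    segmentMean g t (s - t) = segmentMean g s (t - s) := by
  unfold segmentMean
  rw [integral_Icc_eq_integral_Ioc, integral_Icc_eq_integral_Ioc,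
    ← intervalIntegral.integral_of_le zero_le_one, ← intervalIntegral.integral_of_le zero_le_one]
  have h := intervalIntegral.integral_comp_sub_left (a := 0) (b := 1)
    (fun x => g (s + (t - s) * x)) 1
  simp only [sub_zero, sub_self] at h
  rw [← h]
  congr 1
  ext x
  congr 1
  ring

lemma abs_segmentMean_sub_le {p γ : ℝ} (hp : 1 < p) (hγ : 0 < γ) {g : ℝ → ℝ}
    (hg : Continuous g) {s h : ℝ} (hh : h ≠ 0) (hs : s ∈ Icc (0 : ℝ) 1)
    (hsh : s + h ∈ Icc (0 : ℝ) 1)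
    (hB : ∫⁻ u in Icc (0 : ℝ) 1, ∫⁻ v in Icc (0 : ℝ) 1, grrKernel p γ g u v ≠ ⊤) :
    |segmentMean g s h - g s| ≤ (2 * (∫⁻ u in Icc (0 : ℝ) 1, ∫⁻ v in Icc (0 : ℝ) 1,
      grrKernel p γ g u v).toReal) ^ p⁻¹ * |h| ^ γ / (1 - (1 / 2) ^ γ) := by
  have hp0 : 0 < p := by linarith
  set B := ∫⁻ u in Icc (0 : ℝ) 1, ∫⁻ v in Icc (0 : ℝ) 1, grrKernel p γ g u v with hBdef
  have hB0 : 0 ≤ B.toReal := ENNReal.toReal_nonneg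
  have hr : ((1 : ℝ) / 2) ^ γ < 1 := Real.rpow_lt_one (by norm_num) (by norm_num) hγ
  have hlim : Tendsto (fun n : ℕ => h * (1 / 2) ^ n) atTop (𝓝 0) := by
    simpa using (tendsto_pow_atTop_nhds_zero_of_lt_one (r := (1 / 2 : ℝ))
      (by norm_num) (by norm_num)).const_mul h
  have hstep : ∀ n : ℕ, dist (segmentMean g s (h * (1 / 2) ^ n))
      (segmentMean g s (h * (1 / 2) ^ (n + 1))) ≤
        (2 * B.toReal) ^ p⁻¹ * |h| ^ γ * ((1 / 2) ^ γ) ^ n := by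
    intro n
    set a := h * (1 / 2) ^ n with ha
    have hhalf : h * (1 / 2) ^ (n + 1) = a / 2 := by rw [ha, pow_succ]; ring
    have ha0 : a ≠ 0 := by positivity
    have hsa : s + a ∈ Icc (0 : ℝ) 1 :=
      add_mul_mem_Icc hs hsh ⟨by positivity, pow_le_one₀ (by norm_num) (by norm_num)⟩
    have hmain := ofReal_abs_segmentMean_sub_half_rpow_le hp hγ hg ha0 hs hsa
    rw [← hBdef, ← ENNReal.ofReal_toReal hB, ← ENNReal.ofReal_mul (by positivity),
      ENNReal.ofReal_le_ofReal_iff (by positivity)] at hmain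
    rw [hhalf, dist_comm, Real.dist_eq]
    have habs : |a| ^ γ = |h| ^ γ * ((1 / 2) ^ γ) ^ n := by
      rw [ha, abs_mul, abs_of_nonneg (by positivity : (0 : ℝ) ≤ (1 / 2) ^ n),
        Real.mul_rpow (by positivity) (by positivity), ← Real.rpow_natCast,
        ← Real.rpow_natCast, ← Real.rpow_mul (by norm_num), ← Real.rpow_mul (by norm_num),
        mul_comm γ]
    rw [mul_assoc, ← habs, ← Real.rpow_le_rpow_iff (by positivity) (by positivity) hp0]
    refine hmain.trans_eq ?_
    rw [Real.mul_rpow (by positivity) (by positivity), Real.rpow_inv_rpow (by positivity) hp0.ne',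
      ← Real.rpow_mul (by positivity)]
    ring
  have := dist_le_of_le_geometric_of_tendsto₀ _ _ hr hstep (tendsto_segmentMean_zero hg s hlim)
  simpa [Real.dist_eq] using this

/-- The one-parameter Garsia–Rodemich–Rumsey inequality for power functions. -/
lemma exists_garsia_rodemich_rumsey {p γ : ℝ} (hp : 1 < p) (hγ : 0 < γ) :
    ∃ C : ℝ, 0 < C ∧ ∀ g : ℝ → ℝ, Continuous g → ∀ s ∈ Icc (0 : ℝ) 1, ∀ t ∈ Icc (0 : ℝ) 1,
      ENNReal.ofReal (|g t - g s| ^ p) ≤ ENNReal.ofReal (C * |t - s| ^ (γ * p)) *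
        ∫⁻ u in Icc (0 : ℝ) 1, ∫⁻ v in Icc (0 : ℝ) 1, grrKernel p γ g u v := by
  have hp0 : 0 < p := by linarith
  have hr : 0 < 1 - ((1 : ℝ) / 2) ^ γ :=
    sub_pos.mpr (Real.rpow_lt_one (by norm_num) (by norm_num) hγ)
  refine ⟨2 * (2 / (1 - (1 / 2) ^ γ)) ^ p, by positivity, fun g hg s hs t ht => ?_⟩
  rcases eq_or_ne s t with rfl | hst
  · simp [Real.zero_rpow hp0.ne']
  have hst' : 0 < |t - s| := abs_pos.mpr (sub_ne_zero.mpr hst.symm)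
  by_cases hB : ∫⁻ u in Icc (0 : ℝ) 1, ∫⁻ v in Icc (0 : ℝ) 1, grrKernel p γ g u v = ⊤
  · rw [hB, ENNReal.mul_top]
    · exact le_top
    · exact (ENNReal.ofReal_pos.mpr (by positivity)).ne'
  have h1 := abs_segmentMean_sub_le hp hγ hg (sub_ne_zero.mpr hst.symm) hs (by simpa using ht) hB
  have h2 := abs_segmentMean_sub_le hp hγ hg (sub_ne_zero.mpr hst) ht (by simpa using hs) hB
  rw [segmentMean_reverse, abs_sub_comm s t] at h2
  set B := ∫⁻ u in Icc (0 : ℝ) 1, ∫⁻ v in Icc (0 : ℝ) 1, grrKernel p γ g u v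
  have hB0 : 0 ≤ B.toReal := ENNReal.toReal_nonneg
  have h3 : |g t - g s| ≤ (2 / (1 - (1 / 2) ^ γ)) * (|t - s| ^ γ * (2 * B.toReal) ^ p⁻¹) := by
    have := abs_sub_le (g t) (segmentMean g s (t - s)) (g s)
    rw [abs_sub_comm (g t) (segmentMean g s (t - s))] at this
    refine (this.trans (add_le_add h2 h1)).trans_eq ?_
    ring
  rw [← ENNReal.ofReal_toReal hB, ← ENNReal.ofReal_mul (by positivity)]
  apply ENNReal.ofReal_le_ofReal
  refine (Real.rpow_le_rpow (abs_nonneg _) h3 hp0.le).trans_eq ?_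
  rw [Real.mul_rpow (by positivity) (by positivity), Real.mul_rpow (by positivity) (by positivity),
    Real.rpow_inv_rpow (by positivity) hp0.ne', ← Real.rpow_mul (by positivity)]
  ring

lemma setLIntegral_prod_prod {S T : Set ℝ} {F : (ℝ × ℝ) × ℝ × ℝ → ENNReal} (hF : Measurable F) :
    ∫⁻ q in (S ×ˢ S) ×ˢ (T ×ˢ T), F q =
      ∫⁻ u₁ in S, ∫⁻ u₂ in S, ∫⁻ v₁ in T, ∫⁻ v₂ in T, F ((u₁, u₂), v₁, v₂) := by
  simp only [Measure.volume_eq_prod]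
  rw [← Measure.prod_restrict, ← Measure.prod_restrict, ← Measure.prod_restrict,
    lintegral_prod _ hF.aemeasurable, lintegral_prod _ hF.lintegral_prod_right'.aemeasurable]
  refine lintegral_congr fun u₁ => lintegral_congr fun u₂ => ?_
  exact lintegral_prod _ (hF.comp measurable_prodMk_left).aemeasurable

/-- **Two-parameter Garsia–Rodemich–Rumsey inequality.**
For `p > 1` and `α, β ∈ (1/3, 1/2]` there exists a constant `C = C(α,β,p)` such that
for every continuous `y : [0,1]² → ℝ` and all `s₁,s₂,t₁,t₂ ∈ [0,1]`:
`|(δy)(s₁,s₂;t₁,t₂)|^p ≤ C |s₂−s₁|^{αp} |t₂−t₁|^{βp} ·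
  ∫_{[0,1]⁴} |(δy)(u₁,u₂;v₁,v₂)|^p / (|u₂−u₁|^{αp+2}|v₂−v₁|^{βp+2})`,
the inequality being understood in `[0,∞]`. -/
theorem stmt9 (p α β : ℝ) (hp : 1 < p)
    (hα : α ∈ Set.Ioc (1/3 : ℝ) (1/2)) (hβ : β ∈ Set.Ioc (1/3 : ℝ) (1/2)) :
    ∃ C : ℝ, 0 < C ∧ ∀ y : ℝ → ℝ → ℝ,
      ContinuousOn (fun q : ℝ × ℝ => y q.1 q.2) (Icc 0 1 ×ˢ Icc 0 1) →
      ∀ s₁ s₂ t₁ t₂ : ℝ, s₁ ∈ Icc (0:ℝ) 1 → s₂ ∈ Icc (0:ℝ) 1 →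
        t₁ ∈ Icc (0:ℝ) 1 → t₂ ∈ Icc (0:ℝ) 1 →
        ENNReal.ofReal (|dd y s₁ s₂ t₁ t₂| ^ p) ≤
          ENNReal.ofReal (C * |s₂ - s₁| ^ (α * p) * |t₂ - t₁| ^ (β * p)) *
            ∫⁻ q : (ℝ × ℝ) × ℝ × ℝ in (Icc 0 1 ×ˢ Icc 0 1) ×ˢ (Icc 0 1 ×ˢ Icc 0 1),
              ENNReal.ofReal (|dd y q.1.1 q.1.2 q.2.1 q.2.2| ^ p /
                (|q.1.2 - q.1.1| ^ (α * p + 2) * |q.2.2 - q.2.1| ^ (β * p + 2))) := by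
  obtain ⟨C₁, hC₁, h₁⟩ := exists_garsia_rodemich_rumsey hp (by linarith [hα.1] : 0 < α)
  obtain ⟨C₂, hC₂, h₂⟩ := exists_garsia_rodemich_rumsey hp (by linarith [hβ.1] : 0 < β)
  refine ⟨C₁ * C₂, by positivity, fun y hy s₁ s₂ t₁ t₂ hs₁ hs₂ ht₁ ht₂ => ?_⟩
  let π : ℝ → ℝ := fun x => projIcc (0 : ℝ) 1 zero_le_one x
  have hπc : Continuous π := continuous_subtype_val.comp continuous_projIcc
  have hπ : ∀ x ∈ Icc (0 : ℝ) 1, π x = x := fun x hx => by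
    simp only [π, projIcc_of_mem zero_le_one hx]
  let z : ℝ → ℝ → ℝ := fun a b => y (π a) (π b)
  have hz : Continuous fun q : ℝ × ℝ => z q.1 q.2 :=
    hy.comp_continuous (f := fun q : ℝ × ℝ => (π q.1, π q.2)) (by fun_prop)
      fun q => ⟨Subtype.prop _, Subtype.prop _⟩
  have hz' : ∀ {X : Type} [TopologicalSpace X] {f g : X → ℝ}, Continuous f → Continuous g →
      Continuous fun x => z (f x) (g x) := fun hf hg => hz.comp (hf.prodMk hg)
  have hdd : ∀ a ∈ Icc (0 : ℝ) 1, ∀ b ∈ Icc (0 : ℝ) 1, ∀ c ∈ Icc (0 : ℝ) 1,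
      ∀ d ∈ Icc (0 : ℝ) 1, dd y a b c d = dd z a b c d := by
    intro a ha b hb c hc d hd
    simp only [dd, z, hπ a ha, hπ b hb, hπ c hc, hπ d hd]
  have hddc : Continuous fun q : (ℝ × ℝ) × ℝ × ℝ => dd z q.1.1 q.1.2 q.2.1 q.2.2 := by
    unfold dd
    exact (((hz' (by fun_prop) (by fun_prop)).sub (hz' (by fun_prop) (by fun_prop))).sub
      (hz' (by fun_prop) (by fun_prop))).add (hz' (by fun_prop) (by fun_prop))
  have hrw : ∫⁻ q : (ℝ × ℝ) × ℝ × ℝ in (Icc 0 1 ×ˢ Icc 0 1) ×ˢ (Icc 0 1 ×ˢ Icc 0 1),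
      ENNReal.ofReal (|dd y q.1.1 q.1.2 q.2.1 q.2.2| ^ p /
        (|q.1.2 - q.1.1| ^ (α * p + 2) * |q.2.2 - q.2.1| ^ (β * p + 2))) =
      ∫⁻ u₁ in Icc (0 : ℝ) 1, ∫⁻ u₂ in Icc (0 : ℝ) 1, ∫⁻ v₁ in Icc (0 : ℝ) 1,
        ∫⁻ v₂ in Icc (0 : ℝ) 1, ENNReal.ofReal (|dd z u₁ u₂ v₁ v₂| ^ p /
          (|u₂ - u₁| ^ (α * p + 2) * |v₂ - v₁| ^ (β * p + 2))) := by
    rw [← setLIntegral_prod_prod (F := fun q => ENNReal.ofReal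
      (|dd z q.1.1 q.1.2 q.2.1 q.2.2| ^ p /
        (|q.1.2 - q.1.1| ^ (α * p + 2) * |q.2.2 - q.2.1| ^ (β * p + 2))))]
    · refine setLIntegral_congr_fun (by measurability) fun q hq => ?_
      obtain ⟨⟨h1, h2⟩, h3, h4⟩ := hq
      simp only [hdd _ h1 _ h2 _ h3 _ h4]
    · have := hddc.measurable
      fun_prop
  rw [hrw, hdd _ hs₁ _ hs₂ _ ht₁ _ ht₂]
  have hs := h₁ (fun a => z a t₂ - z a t₁)
    ((hz' continuous_id continuous_const).sub (hz' continuous_id continuous_const)) s₁ hs₁ s₂ hs₂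
  have hkernel : ∀ u₁ u₂, grrKernel p α (fun a => z a t₂ - z a t₁) u₁ u₂ ≤
      ENNReal.ofReal (C₂ * |t₂ - t₁| ^ (β * p)) * ∫⁻ v₁ in Icc (0 : ℝ) 1,
        ∫⁻ v₂ in Icc (0 : ℝ) 1, ENNReal.ofReal (|dd z u₁ u₂ v₁ v₂| ^ p /
          (|u₂ - u₁| ^ (α * p + 2) * |v₂ - v₁| ^ (β * p + 2))) := by
    intro u₁ u₂
    have ht := h₂ (fun b => z u₂ b - z u₁ b)
      ((hz' continuous_const continuous_id).sub (hz' continuous_const continuous_id)) t₁ ht₁ t₂ ht₂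
    have hsplit : ∀ v₁ v₂, ENNReal.ofReal (|dd z u₁ u₂ v₁ v₂| ^ p /
        (|u₂ - u₁| ^ (α * p + 2) * |v₂ - v₁| ^ (β * p + 2))) =
        ENNReal.ofReal (|u₂ - u₁| ^ (α * p + 2))⁻¹ *
          grrKernel p β (fun b => z u₂ b - z u₁ b) v₁ v₂ := by
      intro v₁ v₂
      rw [grrKernel, ← ENNReal.ofReal_mul (by positivity),
        show dd z u₁ u₂ v₁ v₂ = z u₂ v₂ - z u₁ v₂ - (z u₂ v₁ - z u₁ v₁) by unfold dd; ring]
      congr 1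
      rw [div_eq_mul_inv, div_eq_mul_inv, mul_inv]
      ring
    simp only [hsplit, lintegral_const_mul' _ _ ENNReal.ofReal_ne_top]
    rw [mul_left_comm, grrKernel, div_eq_mul_inv, mul_comm, ENNReal.ofReal_mul (by positivity),
      show z u₂ t₂ - z u₂ t₁ - (z u₁ t₂ - z u₁ t₁) =
        z u₂ t₂ - z u₁ t₂ - (z u₂ t₁ - z u₁ t₁) by ring]
    gcongr
  rw [show dd z s₁ s₂ t₁ t₂ = z s₂ t₂ - z s₂ t₁ - (z s₁ t₂ - z s₁ t₁) by unfold dd; ring]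
  refine hs.trans ((mul_le_mul_right (lintegral_mono fun u₁ => lintegral_mono fun u₂ =>
    hkernel u₁ u₂) _).trans_eq ?_)
  simp only [lintegral_const_mul' _ _ ENNReal.ofReal_ne_top]
  rw [← mul_assoc, ← ENNReal.ofReal_mul (by positivity)]
  congr 2
  ring
end
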